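/- arXiv:0910.3482 — 3 statements merged into one kernel-verified Lean document; each statement's English description precedes it below -/
import Mathlib

section
/- For any integers m, n, the value of the Markoff-Davenport form of an algebraic hyperbolic 2-dimensional MCRS-group A at an integer point of the k-geometric continued fraction of A satisfies |Φ_A(m,n)| ≥ k·α, where α is the minimal nonzero value of |Φ_A| on integer points (the Markoff minimum of A). -/
/-- The nonzero integer points of a subset `C` of the plane. -/
def latticePoints (C : Set (ℝ × ℝ)) : Set (ℝ × ℝ) :=
  {v | v ∈ C ∧ v ≠ 0 ∧ ∃ p q : ℤ, v = ((p : ℝ), (q : ℝ))}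

/-- Auxiliary construction: `sailAux C k = (k-sail of C, union of the j-sails, j ≤ k)`.
The `(k+1)`-sail is the boundary of the convex hull of the nonzero integer points
of `C` not lying on the `1`-, …, `k`-sails. -/
noncomputable def sailAux (C : Set (ℝ × ℝ)) : ℕ → Set (ℝ × ℝ) × Set (ℝ × ℝ)
  | 0 => (∅, ∅)
  | k + 1 =>
    let u := (sailAux C k).2
    let s := frontier (convexHull ℝ (latticePoints C \ u))
    (s, u ∪ s)

/-- The `k`-sail of `C`. -/
noncomputable def ksail (C : Set (ℝ × ℝ)) (k : ℕ) : Set (ℝ × ℝ) :=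
  (sailAux C k).1

/-- One of the four closed cones cut out by the two eigenlines `x = α₁ y` and
`x = α₂ y` (for sign choices `s, t ∈ {1, -1}`). -/
def eigenCone (α₁ α₂ s t : ℝ) : Set (ℝ × ℝ) :=
  {v | 0 ≤ s * (v.1 - α₁ * v.2) ∧ 0 ≤ t * (v.1 - α₂ * v.2)}

/-- The `k`-geometric continued fraction: the union of the four `k`-sails. -/
noncomputable def geomCF (α₁ α₂ : ℝ) (k : ℕ) : Set (ℝ × ℝ) :=
  ksail (eigenCone α₁ α₂ 1 1) k ∪ ksail (eigenCone α₁ α₂ 1 (-1)) k ∪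
  ksail (eigenCone α₁ α₂ (-1) 1) k ∪ ksail (eigenCone α₁ α₂ (-1) (-1)) k

/-- The Markoff-Davenport form `Φ_A(m,n) = (m - α₁n)(m - α₂n)/(α₁ - α₂)`. -/
noncomputable def mdForm (α₁ α₂ x y : ℝ) : ℝ :=
  (x - α₁ * y) * (x - α₂ * y) / (α₁ - α₂)

/-- `A` is algebraic: some `GL(2,ℤ)`-matrix has the two lines `x = αᵢ y` as
eigenlines, with distinct (real) eigenvalues. -/
def IsAlgebraicPair (α₁ α₂ : ℝ) : Prop :=
  ∃ g : Matrix (Fin 2) (Fin 2) ℤ, (g.det = 1 ∨ g.det = -1) ∧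
    ∃ lam mu : ℝ, lam ≠ mu ∧
      (g.map (Int.cast : ℤ → ℝ)).mulVec ![α₁, 1] = lam • ![α₁, 1] ∧
      (g.map (Int.cast : ℤ → ℝ)).mulVec ![α₂, 1] = mu • ![α₂, 1]

/-- The inclusion of the integer lattice into the plane. -/
def latticeIncl : ℤ × ℤ →+ ℝ × ℝ :=
  (Int.castAddHom ℝ).prodMap (Int.castAddHom ℝ)

@[simp]
lemma latticeIncl_apply (z : ℤ × ℤ) : latticeIncl z = ((z.1 : ℝ), (z.2 : ℝ)) := rfl

/-- For a basis `w₁, w₂` of determinant one, the linear function that is one on `w₁` and `w₂`. -/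
def basisHeight (w₁ w₂ z : ℤ × ℤ) : ℤ :=
  (z.1 * w₂.2 - z.2 * w₂.1) + (w₁.1 * z.2 - w₁.2 * z.1)

/-- A positively oriented lattice basis in an open cone can be reduced, keeping a given point in
its nonnegative span, until its height function is at least one on the lattice points of the
cone. -/
lemma exists_reduced_basis (A B : ℤ × ℤ →+ ℝ) {c : ℝ}
    (hmin : ∀ z, 0 < A z → 0 < B z → c ≤ A z * B z) (N : ℕ) :
    ∀ (v₁ v₂ : ℤ × ℤ) (m n : ℕ), 0 < A v₁ → 0 < B v₁ → 0 < A v₂ → 0 < B v₂ →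
      v₁.1 * v₂.2 - v₁.2 * v₂.1 = 1 → A (v₁ + v₂) * B (v₁ + v₂) ≤ N * c →
      ∃ (w₁ w₂ : ℤ × ℤ) (m' n' : ℕ), (0 < A w₁ ∧ 0 < B w₁) ∧ (0 < A w₂ ∧ 0 < B w₂) ∧
        w₁.1 * w₂.2 - w₁.2 * w₂.1 = 1 ∧ m • v₁ + n • v₂ = m' • w₁ + n' • w₂ ∧
        ∀ z, 0 < A z → 0 < B z → 1 ≤ basisHeight w₁ w₂ z := by
  induction N with
  | zero =>
    intro v₁ v₂ m n hA₁ hB₁ hA₂ hB₂ _ hle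
    have h₁ : 0 < A (v₁ + v₂) := by rw [map_add]; positivity
    have h₂ : 0 < B (v₁ + v₂) := by rw [map_add]; positivity
    have h₃ := mul_pos h₁ h₂
    rw [Nat.cast_zero, zero_mul] at hle
    linarith
  | succ N ih =>
    intro v₁ v₂ m n hA₁ hB₁ hA₂ hB₂ hdet hle
    by_cases hz : ∀ z, 0 < A z → 0 < B z → 1 ≤ basisHeight v₁ v₂ z
    · exact ⟨v₁, v₂, m, n, ⟨hA₁, hB₁⟩, ⟨hA₂, hB₂⟩, hdet, rfl, hz⟩
    push Not at hz
    obtain ⟨z, hAz, hBz, hz⟩ := hz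
    obtain ⟨x, hx⟩ : ∃ x, x = z.1 * v₂.2 - z.2 * v₂.1 := ⟨_, rfl⟩
    obtain ⟨y, hy⟩ : ∃ y, y = v₁.1 * z.2 - v₁.2 * z.1 := ⟨_, rfl⟩
    have hxy : x + y ≤ 0 := by
      rw [basisHeight, ← hx, ← hy] at hz
      omega
    have hzxy : z = x • v₁ + y • v₂ := by
      ext
      · simp only [Prod.fst_add, Prod.smul_fst, smul_eq_mul, hx, hy]
        linear_combination -z.1 * hdet
      · simp only [Prod.snd_add, Prod.smul_snd, smul_eq_mul, hx, hy]
        linear_combination -z.2 * hdet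
    have hxyR : (x : ℝ) + y ≤ 0 := by exact_mod_cast hxy
    rw [hzxy, map_add, map_zsmul, map_zsmul, zsmul_eq_mul, zsmul_eq_mul] at hAz hBz
    rw [map_add, map_add] at hle
    push_cast at hle
    have hm₁ := hmin v₁ hA₁ hB₁
    have hm₂ := hmin v₂ hA₂ hB₂
    rcases lt_or_ge 0 y with hy0 | hy0
    · have hyR : (0 : ℝ) < y := by exact_mod_cast hy0
      have hA : 0 < A (v₂ - v₁) := by
        rw [map_sub]
        refine pos_of_mul_pos_right (a := (y : ℝ)) ?_ hyR.le
        nlinarith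
      have hB : 0 < B (v₂ - v₁) := by
        rw [map_sub]
        refine pos_of_mul_pos_right (a := (y : ℝ)) ?_ hyR.le
        nlinarith
      obtain ⟨w₁, w₂, m', n', h₁, h₂, h₃, h₄, h₅⟩ := ih v₁ (v₂ - v₁) (m + n) n hA₁ hB₁ hA hB
        (by simp only [Prod.fst_sub, Prod.snd_sub]; linear_combination hdet)
        (by rw [add_sub_cancel]; nlinarith [mul_pos hA₁ hB₂, mul_pos hA₂ hB₁])
      refine ⟨w₁, w₂, m', n', h₁, h₂, h₃, ?_, h₅⟩
      rw [← h₄, add_smul, smul_sub]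
      abel
    · have hx0 : 0 < x := by
        by_contra! hx0
        have hxR : (x : ℝ) ≤ 0 := by exact_mod_cast hx0
        have hyR : (y : ℝ) ≤ 0 := by exact_mod_cast hy0
        nlinarith
      have hxR : (0 : ℝ) < x := by exact_mod_cast hx0
      have hA : 0 < A (v₁ - v₂) := by
        rw [map_sub]
        refine pos_of_mul_pos_right (a := (x : ℝ)) ?_ hxR.le
        nlinarith
      have hB : 0 < B (v₁ - v₂) := by
        rw [map_sub]
        refine pos_of_mul_pos_right (a := (x : ℝ)) ?_ hxR.le
        nlinarith
      obtain ⟨w₁, w₂, m', n', h₁, h₂, h₃, h₄, h₅⟩ := ih (v₁ - v₂) v₂ m (m + n) hA hB hA₂ hB₂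
        (by simp only [Prod.fst_sub, Prod.snd_sub]; linear_combination hdet)
        (by rw [sub_add_cancel]; nlinarith [mul_pos hA₁ hB₂, mul_pos hA₂ hB₁])
      refine ⟨w₁, w₂, m', n', h₁, h₂, h₃, ?_, h₅⟩
      rw [← h₄, add_smul, smul_sub]
      abel

/-- A lattice point of an open cone lies in the nonnegative span of a lattice basis of the cone. -/
lemma exists_basis_smul (A B : ℤ × ℤ →+ ℝ) (v : ℤ × ℤ) (hA : 0 < A v) (hB : 0 < B v) :
    ∃ (v₁ v₂ : ℤ × ℤ) (m : ℕ), 0 < A v₁ ∧ 0 < B v₁ ∧ 0 < A v₂ ∧ 0 < B v₂ ∧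
      v₁.1 * v₂.2 - v₁.2 * v₂.1 = 1 ∧ v = m • v₁ := by
  have hv : v ≠ 0 := by
    rintro rfl
    simp at hA
  have hd : 0 < Int.gcd v.1 v.2 := by
    rw [Nat.pos_iff_ne_zero, Ne, Int.gcd_eq_zero_iff]
    exact fun h => hv (Prod.ext h.1 h.2)
  obtain ⟨p, q, hpq, hp, hq⟩ := Int.exists_gcd_one hd
  have hsmul : v = Int.gcd v.1 v.2 • (p, q) := by
    ext
    · simpa [mul_comm] using hp
    · simpa [mul_comm] using hq
  have hdR : (0 : ℝ) ≤ Int.gcd v.1 v.2 := Nat.cast_nonneg _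
  obtain ⟨x, y, hxy⟩ := Int.isCoprime_iff_gcd_eq_one.2 hpq
  have hA₁ : 0 < A (p, q) := by
    rw [hsmul, map_nsmul, nsmul_eq_mul] at hA
    exact pos_of_mul_pos_right hA hdR
  have hB₁ : 0 < B (p, q) := by
    rw [hsmul, map_nsmul, nsmul_eq_mul] at hB
    exact pos_of_mul_pos_right hB hdR
  obtain ⟨M, hM⟩ := exists_nat_gt (-A (-y, x) / A (p, q))
  obtain ⟨N, hN⟩ := exists_nat_gt (-B (-y, x) / B (p, q))
  rw [div_lt_iff₀ hA₁] at hM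
  rw [div_lt_iff₀ hB₁] at hN
  refine ⟨(p, q), (-y, x) + (M + N) • (p, q), _, hA₁, hB₁, ?_, ?_, ?_, hsmul⟩
  · rw [map_add, map_nsmul, nsmul_eq_mul]
    push_cast
    nlinarith [mul_nonneg (Nat.cast_nonneg (α := ℝ) N) hA₁.le]
  · rw [map_add, map_nsmul, nsmul_eq_mul]
    push_cast
    nlinarith [mul_nonneg (Nat.cast_nonneg (α := ℝ) M) hB₁.le]
  · simp only [Prod.fst_add, Prod.snd_add, Prod.smul_fst, Prod.smul_snd]
    simp only [nsmul_eq_mul]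
    linear_combination hxy

/-- A lattice point of an open cone lies in the nonnegative span of a lattice basis whose height
function is at least one on the lattice points of the cone. -/
lemma exists_supporting_basis (A B : ℤ × ℤ →+ ℝ) {c : ℝ} (hc : 0 < c)
    (hmin : ∀ z, 0 < A z → 0 < B z → c ≤ A z * B z) (v : ℤ × ℤ) (hA : 0 < A v) (hB : 0 < B v) :
    ∃ (w₁ w₂ : ℤ × ℤ) (m n : ℕ), (0 < A w₁ ∧ 0 < B w₁) ∧ (0 < A w₂ ∧ 0 < B w₂) ∧
      v = m • w₁ + n • w₂ ∧ basisHeight w₁ w₂ v = m + n ∧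
      ∀ z, 0 < A z → 0 < B z → 1 ≤ basisHeight w₁ w₂ z := by
  obtain ⟨v₁, v₂, l, hA₁, hB₁, hA₂, hB₂, hdet, hl⟩ := exists_basis_smul A B v hA hB
  obtain ⟨N, hN⟩ := exists_nat_ge (A (v₁ + v₂) * B (v₁ + v₂) / c)
  rw [div_le_iff₀ hc] at hN
  obtain ⟨w₁, w₂, m, n, hw₁, hw₂, hw, hmn, hht⟩ :=
    exists_reduced_basis A B hmin N v₁ v₂ l 0 hA₁ hB₁ hA₂ hB₂ hdet hN
  rw [zero_smul, add_zero, ← hl] at hmn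
  refine ⟨w₁, w₂, m, n, hw₁, hw₂, hmn, ?_, hht⟩
  rw [hmn]
  simp only [basisHeight, Prod.fst_add, Prod.snd_add, Prod.smul_fst, Prod.smul_snd]
  simp only [nsmul_eq_mul]
  linear_combination ((m : ℤ) + n) * hw

/-- A linear functional bounded below by a positive number on a set is strictly above this bound
on the interior. -/
lemma lt_of_mem_interior_of_forall_le (f : ℝ × ℝ →ₗ[ℝ] ℝ) {X : Set (ℝ × ℝ)} {r : ℝ} (hr : 0 < r)
    (hX : ∀ x ∈ X, r ≤ f x) {x : ℝ × ℝ} (hx : x ∈ interior X) : r < f x := by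
  have hcont : Filter.Tendsto (fun t : ℝ => t • x) (nhds 1) (nhds x) := by
    have : Continuous fun t : ℝ => t • x := by fun_prop
    simpa using this.tendsto 1
  have h₁ : ∀ᶠ t : ℝ in nhds 1, t • x ∈ X := hcont.eventually (mem_interior_iff_mem_nhds.1 hx)
  have h₂ : ∀ᶠ t : ℝ in nhds 1, 0 < t := lt_mem_nhds one_pos
  obtain ⟨t, ⟨htX, ht0⟩, ht1⟩ :=
    (((h₁.and h₂).filter_mono nhdsWithin_le_nhds).and
      (self_mem_nhdsWithin (s := Set.Iio (1 : ℝ)))).exists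
  have h := hX _ htX
  rw [map_smul, smul_eq_mul] at h
  have ht1' : t < 1 := ht1
  by_contra! hle
  nlinarith

/-- A lattice point avoiding the first `k` sails of a cone is the sum of at least `k + 1` lattice
points of the cone. -/
lemma exists_sum_of_notMem_sails {C : Set (ℝ × ℝ)} (A B : ℤ × ℤ →+ ℝ) {c : ℝ} (hc : 0 < c)
    (hC : ∀ z, z ≠ 0 → latticeIncl z ∈ C → 0 < A z ∧ 0 < B z)
    (hmin : ∀ z, 0 < A z → 0 < B z → c ≤ A z * B z) (k : ℕ) :
    ∀ v, latticeIncl v ∈ latticePoints C \ (sailAux C k).2 →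
      ∃ (w₁ w₂ : ℤ × ℤ) (m n : ℕ), (0 < A w₁ ∧ 0 < B w₁) ∧ (0 < A w₂ ∧ 0 < B w₂) ∧
        v = m • w₁ + n • w₂ ∧ k + 1 ≤ m + n := by
  have hpos : ∀ v, latticeIncl v ∈ latticePoints C → 0 < A v ∧ 0 < B v := by
    rintro v ⟨hvC, hv, -⟩
    refine hC v ?_ hvC
    rintro rfl
    exact hv (map_zero _)
  induction k with
  | zero =>
    rintro v ⟨hv, -⟩
    obtain ⟨hA, hB⟩ := hpos v hv
    obtain ⟨w₁, w₂, m, n, hw₁, hw₂, hmn, hv_ht, hht⟩ :=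
      exists_supporting_basis A B hc hmin v hA hB
    refine ⟨w₁, w₂, m, n, hw₁, hw₂, hmn, ?_⟩
    have := hht v hA hB
    omega
  | succ k ih =>
    rintro v ⟨hv, hvs⟩
    obtain ⟨hA, hB⟩ := hpos v hv
    obtain ⟨w₁, w₂, m, n, hw₁, hw₂, hmn, hv_ht, hht⟩ :=
      exists_supporting_basis A B hc hmin v hA hB
    refine ⟨w₁, w₂, m, n, hw₁, hw₂, hmn, ?_⟩
    have hvs' : latticeIncl v ∉ (sailAux C k).2 ∪
        frontier (convexHull ℝ (latticePoints C \ (sailAux C k).2)) := hvs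
    rw [Set.mem_union, not_or] at hvs'
    have hint : latticeIncl v ∈ interior (convexHull ℝ (latticePoints C \ (sailAux C k).2)) := by
      by_contra h
      exact hvs'.2 ⟨subset_closure (subset_convexHull ℝ _ ⟨hv, hvs'.1⟩), h⟩
    let f : ℝ × ℝ →ₗ[ℝ] ℝ := ((w₂.2 - w₁.2 : ℤ) : ℝ) • LinearMap.fst ℝ ℝ ℝ +
      ((w₁.1 - w₂.1 : ℤ) : ℝ) • LinearMap.snd ℝ ℝ ℝ
    have hf : ∀ z, f (latticeIncl z) = basisHeight w₁ w₂ z := by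
      intro z
      simp [f, basisHeight]
      ring
    have hge : ∀ x ∈ convexHull ℝ (latticePoints C \ (sailAux C k).2), ((k + 1 : ℕ) : ℝ) ≤ f x := by
      refine convexHull_min ?_ (convex_halfSpace_ge f.isLinear _)
      rintro x hx
      obtain ⟨p, q, rfl⟩ := hx.1.2.2
      obtain ⟨u₁, u₂, i, j, hu₁, hu₂, hij, hk⟩ := ih (p, q) hx
      change _ ≤ f (latticeIncl (p, q))
      have h₁ : (1 : ℝ) ≤ f (latticeIncl u₁) := by
        rw [hf]
        exact_mod_cast hht u₁ hu₁.1 hu₁.2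
      have h₂ : (1 : ℝ) ≤ f (latticeIncl u₂) := by
        rw [hf]
        exact_mod_cast hht u₂ hu₂.1 hu₂.2
      have hk' : ((k + 1 : ℕ) : ℝ) ≤ i + j := by exact_mod_cast hk
      rw [hij, map_add, map_nsmul, map_nsmul, map_add, map_nsmul, map_nsmul, nsmul_eq_mul,
        nsmul_eq_mul]
      nlinarith [mul_le_mul_of_nonneg_left h₁ (Nat.cast_nonneg (α := ℝ) i),
        mul_le_mul_of_nonneg_left h₂ (Nat.cast_nonneg (α := ℝ) j)]
    have hlt := lt_of_mem_interior_of_forall_le f (by positivity) hge hint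
    rw [hf, hv_ht] at hlt
    have : k + 1 < m + n := by exact_mod_cast hlt
    omega

/-- If two products of nonnegative numbers are at least `r`, the sum of the cross products is at
least `2 * r`. -/
lemma two_mul_le_cross_add_cross {r x₁ x₂ y₁ y₂ : ℝ} (hr : 0 ≤ r) (hx₁ : 0 ≤ x₁) (hx₂ : 0 ≤ x₂)
    (hy₁ : 0 ≤ y₁) (hy₂ : 0 ≤ y₂) (hx : r ≤ x₁ * x₂) (hy : r ≤ y₁ * y₂) :
    2 * r ≤ x₁ * y₂ + y₁ * x₂ := by
  refine (abs_le_of_sq_le_sq' ?_ (by positivity)).2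
  nlinarith [sq_nonneg (x₁ * y₂ - y₁ * x₂), mul_le_mul hx hy hr (by positivity)]

/-- Superlevel sets of a product of two linear functionals are convex in the cone where both are
nonnegative. -/
lemma convex_setOf_le_mul (A B : ℝ × ℝ →ₗ[ℝ] ℝ) {r : ℝ} (hr : 0 ≤ r) :
    Convex ℝ {x | 0 ≤ A x ∧ 0 ≤ B x ∧ r ≤ A x * B x} := by
  rintro x ⟨hxA, hxB, hx⟩ y ⟨hyA, hyB, hy⟩ a b ha hb hab
  simp only [Set.mem_ofPred_eq, map_add, map_smul, smul_eq_mul]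
  refine ⟨by positivity, by positivity, ?_⟩
  have hcross := two_mul_le_cross_add_cross hr hxA hxB hyA hyB hx hy
  obtain rfl : b = 1 - a := by linarith
  nlinarith [mul_le_mul_of_nonneg_left hx (mul_nonneg ha ha),
    mul_le_mul_of_nonneg_left hy (mul_nonneg hb hb),
    mul_le_mul_of_nonneg_left hcross (mul_nonneg ha hb)]

/-- On the `k`-sail of a cone, the product of the functionals defining the cone is at least `k`
times its minimum over the lattice points of the open cone. -/
lemma le_mul_of_mem_ksail (A B : ℝ × ℝ →ₗ[ℝ] ℝ) {c : ℝ} (hc : 0 < c)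
    (hne : ∀ z, z ≠ 0 → A (latticeIncl z) ≠ 0 ∧ B (latticeIncl z) ≠ 0)
    (hmin : ∀ z, 0 < A (latticeIncl z) → 0 < B (latticeIncl z) →
      c ≤ A (latticeIncl z) * B (latticeIncl z))
    (k : ℕ) {x : ℝ × ℝ} (hx : x ∈ ksail {v | 0 ≤ A v ∧ 0 ≤ B v} k) : k * c ≤ A x * B x := by
  cases k with
  | zero => exact hx.elim
  | succ k =>
    have hx' : x ∈ frontier (convexHull ℝ
      (latticePoints {v | 0 ≤ A v ∧ 0 ≤ B v} \ (sailAux {v | 0 ≤ A v ∧ 0 ≤ B v} k).2)) := hx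
    have hAc : Continuous A := A.continuous_of_finiteDimensional
    have hBc : Continuous B := B.continuous_of_finiteDimensional
    have hclosed : IsClosed {x | 0 ≤ A x ∧ 0 ≤ B x ∧ ((k + 1 : ℕ) : ℝ) * c ≤ A x * B x} :=
      (isClosed_le continuous_const hAc).inter
        ((isClosed_le continuous_const hBc).inter (isClosed_le continuous_const (hAc.mul hBc)))
    refine (closure_minimal (convexHull_min ?_ (convex_setOf_le_mul A B (by positivity))) hclosed
      (frontier_subset_closure hx')).2.2
    rintro y hy
    obtain ⟨p, q, rfl⟩ := hy.1.2.2
    obtain ⟨w₁, w₂, m, n, hw₁, hw₂, hmn, hk⟩ := exists_sum_of_notMem_sails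
      (A.toAddMonoidHom.comp latticeIncl) (B.toAddMonoidHom.comp latticeIncl) hc
      (fun z hz hzC => ⟨lt_of_le_of_ne hzC.1 (hne z hz).1.symm,
        lt_of_le_of_ne hzC.2 (hne z hz).2.symm⟩) hmin k (p, q) hy
    refine ⟨hy.1.1.1, hy.1.1.2, ?_⟩
    have hk' : ((k + 1 : ℕ) : ℝ) ≤ ((m + n : ℕ) : ℝ) := Nat.cast_le.2 hk
    have hone : (1 : ℝ) ≤ ((m + n : ℕ) : ℝ) := by
      exact_mod_cast (Nat.le_add_left 1 k).trans hk
    change A (latticeIncl w₁) > 0 ∧ B (latticeIncl w₁) > 0 at hw₁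
    change A (latticeIncl w₂) > 0 ∧ B (latticeIncl w₂) > 0 at hw₂
    have h₁ := hmin w₁ hw₁.1 hw₁.2
    have h₂ := hmin w₂ hw₂.1 hw₂.2
    have hcross :=
      two_mul_le_cross_add_cross hc.le hw₁.1.le hw₁.2.le hw₂.1.le hw₂.2.le h₁ h₂
    change _ ≤ A (latticeIncl (p, q)) * B (latticeIncl (p, q))
    have hm : (0 : ℝ) ≤ m := Nat.cast_nonneg m
    have hn : (0 : ℝ) ≤ n := Nat.cast_nonneg n
    calc ((k + 1 : ℕ) : ℝ) * c ≤ ((m + n : ℕ) : ℝ) * c := by gcongr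
      _ ≤ (((m + n : ℕ) : ℝ) * (m + n : ℕ)) * c := by
        gcongr
        exact le_mul_of_one_le_left (Nat.cast_nonneg _) hone
      _ ≤ A (latticeIncl (p, q)) * B (latticeIncl (p, q)) := by
        rw [hmn, map_add, map_nsmul, map_nsmul, map_add, map_add, map_nsmul, map_nsmul,
          map_nsmul, map_nsmul]
        simp only [nsmul_eq_mul]
        push_cast
        nlinarith [mul_le_mul_of_nonneg_left h₁ (mul_nonneg hm hm),
          mul_le_mul_of_nonneg_left h₂ (mul_nonneg hn hn),
          mul_le_mul_of_nonneg_left hcross (mul_nonneg hm hn)]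

/-- Lemma: an integer point on the `k`-geometric continued fraction of an
algebraic hyperbolic MCRS-group `A` satisfies `|Φ_A(m,n)| ≥ k·α`, where `α` is
the Markoff minimum (the least positive value of `|Φ_A|` at integer points). -/
theorem mdForm_ge_on_ksail (α₁ α₂ : ℝ)
    (h₁ : Irrational α₁) (h₂ : Irrational α₂) (hne : α₁ ≠ α₂)
    (halg : IsAlgebraicPair α₁ α₂)
    (a : ℝ) (hmin : IsLeast {t : ℝ | 0 < t ∧ ∃ p q : ℤ, t = |mdForm α₁ α₂ p q|} a) :
    ∀ (k : ℕ) (p q : ℤ), ((p : ℝ), (q : ℝ)) ∈ geomCF α₁ α₂ k →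
      |mdForm α₁ α₂ p q| ≥ k * a := by
  intro k p q hpq
  have hd : 0 < |α₁ - α₂| := abs_pos.2 (sub_ne_zero.2 hne)
  have key : ∀ s t : ℝ, |s| = 1 → |t| = 1 →
      ((p : ℝ), (q : ℝ)) ∈ ksail (eigenCone α₁ α₂ s t) k → |mdForm α₁ α₂ p q| ≥ k * a := by
    intro s t hs ht hmem
    let A : ℝ × ℝ →ₗ[ℝ] ℝ := s • (LinearMap.fst ℝ ℝ ℝ - α₁ • LinearMap.snd ℝ ℝ ℝ)
    let B : ℝ × ℝ →ₗ[ℝ] ℝ := t • (LinearMap.fst ℝ ℝ ℝ - α₂ • LinearMap.snd ℝ ℝ ℝ)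
    have hform : ∀ x : ℝ × ℝ, |A x * B x| = |mdForm α₁ α₂ x.1 x.2| * |α₁ - α₂| := by
      intro x
      rw [mdForm, abs_div, div_mul_cancel₀ _ hd.ne']
      simp [A, B, abs_mul, hs, ht]
    have hirr : ∀ β : ℝ, Irrational β → ∀ z : ℤ × ℤ, z ≠ 0 → (z.1 : ℝ) - β * z.2 ≠ 0 := by
      intro β hβ z hz h0
      by_cases h2 : z.2 = 0
      · rw [h2, Int.cast_zero, mul_zero, sub_zero, Int.cast_eq_zero] at h0
        exact hz (Prod.ext h0 h2)
      · exact ((hβ.mul_intCast h2).intCast_sub z.1).ne_zero h0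
    have hs0 : s ≠ 0 := by
      rintro rfl
      simp at hs
    have ht0 : t ≠ 0 := by
      rintro rfl
      simp at ht
    have h := le_mul_of_mem_ksail A B (mul_pos hmin.1.1 hd)
      (fun z hz => ⟨mul_ne_zero hs0 (hirr α₁ h₁ z hz), mul_ne_zero ht0 (hirr α₂ h₂ z hz)⟩)
      (fun z hA hB => by
        have hf := hform (latticeIncl z)
        rw [abs_of_pos (mul_pos hA hB)] at hf
        have hpos : 0 < |mdForm α₁ α₂ z.1 z.2| :=
          pos_of_mul_pos_left (hf ▸ mul_pos hA hB) hd.le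
        rw [hf]
        exact mul_le_mul_of_nonneg_right (hmin.2 ⟨hpos, z.1, z.2, rfl⟩) hd.le)
      k hmem
    have h' := (h.trans (le_abs_self _)).trans_eq (hform _)
    rw [← mul_assoc] at h'
    exact le_of_mul_le_mul_right h' hd
  rcases hpq with ((h | h) | h) | h
  all_goals exact key _ _ (by norm_num) (by norm_num) h
end

section
/- For an algebraic 2-dimensional MCRS-group A, the k-sail of any of its four cones is homothetic to the 1-sail of the same cone with homothety coefficient k (centered at the origin). -/
open scoped Pointwise

theorem mk_mem_latticePoints {C : Set (ℝ × ℝ)} {m n : ℤ} :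
    ((m : ℝ), (n : ℝ)) ∈ latticePoints C ↔ ((m : ℝ), (n : ℝ)) ∈ C ∧ ¬(m = 0 ∧ n = 0) := by
  constructor
  · rintro ⟨h, h0, -⟩
    exact ⟨h, fun ⟨hm, hn⟩ => h0 (by simp [hm, hn])⟩
  · rintro ⟨h, h0⟩
    refine ⟨h, fun h' => h0 ?_, m, n, rfl⟩
    simpa [Prod.ext_iff] using h'

/-- The integer linear form `(x, y) ↦ c x + d y` is positive on the nonzero integer points
of `C`. -/
def IsPosForm (C : Set (ℝ × ℝ)) (c d : ℤ) : Prop :=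
  ∀ m n : ℤ, ((m : ℝ), (n : ℝ)) ∈ latticePoints C → 0 < c * m + d * n

/-- A nonzero integer point which is a nonnegative rational combination of two points of a
convex cone belongs to the cone. -/
theorem mk_mem_of_smul_eq_add {C : Set (ℝ × ℝ)}
    (hadd : ∀ x ∈ C, ∀ y ∈ C, x + y ∈ C) (hsmul : ∀ c : ℝ, 0 ≤ c → ∀ x ∈ C, c • x ∈ C)
    {m n m' n' w₁ w₂ a b D : ℤ} (hp : ((m : ℝ), (n : ℝ)) ∈ C) (hq : ((m' : ℝ), (n' : ℝ)) ∈ C)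
    (ha : 0 ≤ a) (hb : 0 ≤ b) (hD : 0 < D) (h₁ : D * w₁ = a * m + b * m')
    (h₂ : D * w₂ = a * n + b * n') : ((w₁ : ℝ), (w₂ : ℝ)) ∈ C := by
  have hD' : (0 : ℝ) < D := by exact_mod_cast hD
  have h₁' : (D : ℝ) * w₁ = a * m + b * m' := by exact_mod_cast h₁
  have h₂' : (D : ℝ) * w₂ = a * n + b * n' := by exact_mod_cast h₂
  have := hsmul (D : ℝ)⁻¹ (by positivity) _ (hadd _ (hsmul a (by exact_mod_cast ha) _ hp) _
    (hsmul b (by exact_mod_cast hb) _ hq))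
  convert this using 1
  simp only [Prod.smul_mk, Prod.mk_add_mk, smul_eq_mul]
  rw [← h₁', ← h₂']
  field_simp

/-- Let `f = (c, d)`, `g = (-e₂, e₁)` be dual to the basis `(e₁, e₂), (-d, c)` of `ℤ²`. If `w` is
the point with `f w = 1`, `g w = j`, and `p`, `q` are points of the cone on different sides of
the line through `w`, then `w` is in the cone. -/
theorem mk_mem_of_between {C : Set (ℝ × ℝ)}
    (hadd : ∀ x ∈ C, ∀ y ∈ C, x + y ∈ C) (hsmul : ∀ c : ℝ, 0 ≤ c → ∀ x ∈ C, c • x ∈ C)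
    {c d e₁ e₂ j m n m' n' : ℤ} (he : c * e₁ + d * e₂ = 1)
    (hp : ((m : ℝ), (n : ℝ)) ∈ C) (hq : ((m' : ℝ), (n' : ℝ)) ∈ C)
    (hfp : 0 < c * m + d * n) (hfq : 0 < c * m' + d * n')
    (hgp : j * (c * m + d * n) ≤ e₁ * n - e₂ * m)
    (hgq : e₁ * n' - e₂ * m' ≤ j * (c * m' + d * n')) :
    (((e₁ - j * d : ℤ) : ℝ), ((e₂ + j * c : ℤ) : ℝ)) ∈ latticePoints C := by
  refine mk_mem_latticePoints.2 ⟨?_, fun ⟨h₁, h₂⟩ => ?_⟩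
  · rcases hgp.eq_or_lt with h | h
    · refine mk_mem_of_smul_eq_add hadd hsmul hp hp zero_le_one le_rfl hfp ?_ ?_
      · linear_combination m * he - d * h
      · linear_combination n * he + c * h
    · refine mk_mem_of_smul_eq_add hadd hsmul hq hp
        (a := (e₁ * n - e₂ * m) - j * (c * m + d * n))
        (b := j * (c * m' + d * n') - (e₁ * n' - e₂ * m'))
        (D := (c * m' + d * n') * (e₁ * n - e₂ * m) - (e₁ * n' - e₂ * m') * (c * m + d * n))
        (by linarith) (by linarith) (by nlinarith) ?_ ?_
      · linear_combination ((e₁ * n - e₂ * m - j * (c * m + d * n)) * m' +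
          (j * (c * m' + d * n') - (e₁ * n' - e₂ * m')) * m) * he
      · linear_combination ((e₁ * n - e₂ * m - j * (c * m + d * n)) * n' +
          (j * (c * m' + d * n') - (e₁ * n' - e₂ * m')) * n) * he
  · have : (c * e₁ + d * e₂) = 0 := by linear_combination c * h₁ + d * h₂
    omega

/-- Every nonzero integer point `p` of a convex cone has a positive integer form `f` such that
`p / f p` lies in the convex hull of the nonzero integer points. -/
theorem exists_isPosForm_inv_smul_mem_convexHull {C : Set (ℝ × ℝ)}
    (hadd : ∀ x ∈ C, ∀ y ∈ C, x + y ∈ C) (hsmul : ∀ c : ℝ, 0 ≤ c → ∀ x ∈ C, c • x ∈ C)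
    (hpos : ∃ c d, IsPosForm C c d) {m n : ℤ} (hp : ((m : ℝ), (n : ℝ)) ∈ latticePoints C) :
    ∃ c d, IsPosForm C c d ∧
      ((c * m + d * n : ℤ) : ℝ)⁻¹ • ((m : ℝ), (n : ℝ)) ∈ convexHull ℝ (latticePoints C) := by
  classical
  have hex : ∃ N : ℕ, ∃ c d, IsPosForm C c d ∧ c * m + d * n = N := by
    obtain ⟨c, d, h⟩ := hpos
    exact ⟨(c * m + d * n).toNat, c, d, h, by rw [Int.toNat_of_nonneg (h m n hp).le]⟩
  obtain ⟨c, d, hcd, ht⟩ := Nat.find_spec hex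
  have hmin : ∀ c' d', IsPosForm C c' d' → c * m + d * n ≤ c' * m + d' * n := by
    intro c' d' h
    rw [ht, ← Int.toNat_of_nonneg (h m n hp).le]
    exact_mod_cast Nat.find_min' hex ⟨c', d', h, by rw [Int.toNat_of_nonneg (h m n hp).le]⟩
  clear ht hex
  have ht := hcd m n hp
  have hpC := (mk_mem_latticePoints.1 hp).1
  -- minimality makes the form primitive
  have hgcd : (Int.gcd c d : ℤ) = 1 := by
    have hg0 : (0 : ℤ) < Int.gcd c d := by
      rw [Int.natCast_pos, Int.gcd_pos_iff]
      by_contra! h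
      simp [h.1, h.2] at ht
    obtain ⟨c', hc'⟩ := Int.gcd_dvd_left c d
    obtain ⟨d', hd'⟩ := Int.gcd_dvd_right c d
    generalize (Int.gcd c d : ℤ) = g at hg0 hc' hd' ⊢
    subst hc' hd'
    have hpos' : IsPosForm C c' d' := fun x y h => by
      have := hcd x y h
      exact pos_of_mul_pos_right (a := g) (by linarith) hg0.le
    have h₁ := hmin _ _ hpos'
    have h₂ := hpos' m n hp
    by_contra hg
    nlinarith [(by omega : 2 ≤ g)]
  obtain ⟨e₁, e₂, he⟩ : ∃ e₁ e₂ : ℤ, c * e₁ + d * e₂ = 1 :=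
    ⟨Int.gcdA c d, Int.gcdB c d, by rw [← Int.gcd_eq_gcd_ab, hgcd]⟩
  refine ⟨c, d, hcd, ?_⟩
  set t := c * m + d * n with htdef
  set y := e₁ * n - e₂ * m with hydef
  have hm : m = t * e₁ - y * d := by rw [htdef, hydef]; linear_combination -m * he
  have hn : n = t * e₂ + y * c := by rw [htdef, hydef]; linear_combination -n * he
  have hmod := Int.emod_nonneg y ht.ne'
  have hmod' := Int.emod_lt_of_pos y ht
  have hdiv := Int.mul_ediv_add_emod y t
  set j := y / t
  set r := y % t
  have hw : (((e₁ - j * d : ℤ) : ℝ), ((e₂ + j * c : ℤ) : ℝ)) ∈ latticePoints C := by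
    have : ¬ IsPosForm C (-e₂ - j * c) (e₁ - j * d) := fun h => by
      have := hmin _ _ h
      nlinarith
    simp only [IsPosForm, not_forall, not_lt] at this
    obtain ⟨m', n', hq, hle⟩ := this
    exact mk_mem_of_between hadd hsmul he hpC (mk_mem_latticePoints.1 hq).1 ht (hcd _ _ hq)
      (by linarith) (by linarith)
  have ht' : (0 : ℝ) < t := by exact_mod_cast ht
  have hm' : (m : ℝ) = t * e₁ - y * d := by exact_mod_cast hm
  have hn' : (n : ℝ) = t * e₂ + y * c := by exact_mod_cast hn
  have hdiv' : (t : ℝ) * j + r = y := by exact_mod_cast hdiv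
  rcases hmod.eq_or_lt with hr | hr
  · apply subset_convexHull
    have hr' : (r : ℝ) = 0 := by exact_mod_cast hr.symm
    convert hw using 1
    rw [Prod.smul_mk, hm', hn', ← hdiv', hr']
    push_cast
    simp only [smul_eq_mul, Prod.mk.injEq]
    constructor <;> field_simp <;> ring
  · have hw' : (((e₁ - (j + 1) * d : ℤ) : ℝ), ((e₂ + (j + 1) * c : ℤ) : ℝ)) ∈
        latticePoints C := by
      have : ¬ IsPosForm C ((j + 1) * c + e₂) ((j + 1) * d - e₁) := fun h => by
        have := hmin _ _ h
        nlinarith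
      simp only [IsPosForm, not_forall, not_lt] at this
      obtain ⟨m', n', hq, hle⟩ := this
      exact mk_mem_of_between hadd hsmul he (mk_mem_latticePoints.1 hq).1 hpC (hcd _ _ hq) ht
        (by linarith) (by nlinarith)
    have hr' : (0 : ℝ) ≤ r := by exact_mod_cast hmod
    have hrt : (r : ℝ) ≤ t := by exact_mod_cast hmod'.le
    have := (convex_convexHull ℝ (latticePoints C)) (subset_convexHull ℝ _ hw)
      (subset_convexHull ℝ _ hw') (a := 1 - r / t) (b := r / t)
      (by rw [sub_nonneg, div_le_one ht']; exact hrt) (by positivity) (by ring)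
    convert this using 1
    rw [hm', hn', ← hdiv']
    push_cast
    simp only [Prod.smul_mk, Prod.mk_add_mk, smul_eq_mul, Prod.mk.injEq]
    constructor <;> field_simp <;> ring

theorem smul_mem_latticePoints {C : Set (ℝ × ℝ)}
    (hsmul : ∀ c : ℝ, 0 ≤ c → ∀ x ∈ C, c • x ∈ C) {N : ℕ} (hN : 1 ≤ N) {p : ℝ × ℝ}
    (hp : p ∈ latticePoints C) : (N : ℝ) • p ∈ latticePoints C := by
  obtain ⟨hpC, hp0, m, n, rfl⟩ := hp
  refine ⟨hsmul _ (by positivity) _ hpC, smul_ne_zero (by positivity) hp0, N * m, N * n, ?_⟩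
  simp

/-- The convex hull of the nonzero integer points of a convex cone is stable under dilations. -/
theorem smul_mem_convexHull_latticePoints {C : Set (ℝ × ℝ)}
    (hsmul : ∀ c : ℝ, 0 ≤ c → ∀ x ∈ C, c • x ∈ C) {r : ℝ} (hr : 1 ≤ r) {x : ℝ × ℝ}
    (hx : x ∈ convexHull ℝ (latticePoints C)) : r • x ∈ convexHull ℝ (latticePoints C) := by
  have key : r • latticePoints C ⊆ convexHull ℝ (latticePoints C) := by
    rintro _ ⟨p, hp, rfl⟩
    have hN : 1 ≤ ⌊r⌋₊ := Nat.le_floor (by exact_mod_cast hr)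
    have h₁ := Nat.floor_le (zero_le_one.trans hr)
    have h₂ := Nat.lt_floor_add_one r
    have := (convex_convexHull ℝ (latticePoints C))
      (subset_convexHull ℝ _ (smul_mem_latticePoints hsmul hN hp))
      (subset_convexHull ℝ _ (smul_mem_latticePoints hsmul (Nat.le_add_left 1 ⌊r⌋₊) hp))
      (a := 1 - (r - ⌊r⌋₊)) (b := r - ⌊r⌋₊) (by linarith) (by linarith) (by ring)
    have hr' : r = (1 - (r - ⌊r⌋₊)) * ⌊r⌋₊ + (r - ⌊r⌋₊) * (⌊r⌋₊ + 1 : ℕ) := by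
      push_cast
      ring
    rwa [smul_smul, smul_smul, ← add_smul, ← hr'] at this
  have := convexHull_min key (convex_convexHull ℝ _)
  rw [convexHull_smul] at this
  exact this (Set.smul_mem_smul_set hx)

/-- A point of the convex hull at which a positive integer form takes the value `1` lies on the
boundary of the hull. -/
theorem mem_frontier_convexHull_latticePoints {C : Set (ℝ × ℝ)} {c d : ℤ}
    (hcd : IsPosForm C c d) {x : ℝ × ℝ} (hx : x ∈ convexHull ℝ (latticePoints C))
    (h : c * x.1 + d * x.2 = 1) : x ∈ frontier (convexHull ℝ (latticePoints C)) := by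
  refine ⟨subset_closure hx, fun hint => ?_⟩
  have hge : convexHull ℝ (latticePoints C) ⊆ {v : ℝ × ℝ | 1 ≤ c * v.1 + d * v.2} := by
    refine convexHull_min ?_ ?_
    · rintro v hv
      obtain ⟨-, -, m, n, rfl⟩ := id hv
      have : (1 : ℤ) ≤ c * m + d * n := hcd m n hv
      simp only [Set.mem_ofPred_eq]
      exact_mod_cast this
    · exact convex_halfSpace_ge (f := fun v : ℝ × ℝ => (c : ℝ) * v.1 + d * v.2)
        ⟨fun v w => by simp; ring, fun a v => by simp; ring⟩ 1
  have hcont : Filter.Tendsto (fun r : ℝ => r • x) (nhdsWithin 1 (Set.Iio 1)) (nhds x) := by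
    have : Continuous fun r : ℝ => r • x := by fun_prop
    simpa using (this.tendsto 1).mono_left nhdsWithin_le_nhds
  obtain ⟨r, hr, hr1⟩ := ((hcont.eventually (mem_interior_iff_mem_nhds.1 hint)).and
    self_mem_nhdsWithin).exists
  have := hge hr
  simp only [Set.mem_ofPred_eq, Prod.smul_fst, Prod.smul_snd, smul_eq_mul] at this
  have h' : c * (r * x.1) + d * (r * x.2) = r := by linear_combination r * h
  rw [h'] at this
  exact absurd hr1 (not_lt.2 this)

/-- If large multiples of the nonzero integer points of `C` have their integer neighbours in `C`,
then proper dilations of these points are interior to the hull. -/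
theorem smul_mem_interior_convexHull_latticePoints {C : Set (ℝ × ℝ)}
    (hopen : ∀ m n : ℤ, ((m : ℝ), (n : ℝ)) ∈ latticePoints C → ∃ N₀ : ℕ, ∀ N ≥ N₀,
      ∀ i ∈ ({-1, 1} : Set ℤ), ∀ j ∈ ({-1, 1} : Set ℤ),
        (((N * m + i : ℤ) : ℝ), ((N * n + j : ℤ) : ℝ)) ∈ latticePoints C)
    {p : ℝ × ℝ} (hp : p ∈ latticePoints C) {r : ℝ} (hr : 1 < r) :
    r • p ∈ interior (convexHull ℝ (latticePoints C)) := by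
  obtain ⟨-, -, m, n, rfl⟩ := id hp
  obtain ⟨N₀, hN₀⟩ := hopen m n hp
  obtain ⟨N₁, hN₁⟩ := exists_nat_gt r
  obtain ⟨N, hN, hrN⟩ : ∃ N : ℕ, N₀ ≤ N ∧ r < N :=
    ⟨max N₀ N₁, le_max_left _ _, hN₁.trans_le (by exact_mod_cast le_max_right _ _)⟩
  have hsub : Set.Icc ((N * m - 1 : ℝ)) (N * m + 1) ×ˢ Set.Icc ((N * n - 1 : ℝ)) (N * n + 1) ⊆
      convexHull ℝ (latticePoints C) := by
    rw [← segment_eq_Icc (by linarith), ← segment_eq_Icc (by linarith), ← convexHull_pair,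
      ← convexHull_pair, ← convexHull_prod]
    refine convexHull_mono ?_
    rintro ⟨a, b⟩ ⟨ha, hb⟩
    have ha' : ∃ i ∈ ({-1, 1} : Set ℤ), a = ((N * m + i : ℤ) : ℝ) := by
      rcases ha with h | h
      · exact ⟨-1, by simp, by simpa [sub_eq_add_neg] using h⟩
      · exact ⟨1, by simp, by simpa using h⟩
    have hb' : ∃ i ∈ ({-1, 1} : Set ℤ), b = ((N * n + i : ℤ) : ℝ) := by
      rcases hb with h | h
      · exact ⟨-1, by simp, by simpa [sub_eq_add_neg] using h⟩
      · exact ⟨1, by simp, by simpa using h⟩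
    obtain ⟨i, hi, rfl⟩ := ha'
    obtain ⟨j, hj, rfl⟩ := hb'
    exact hN₀ N hN i hi j hj
  have hint : (N : ℝ) • ((m : ℝ), (n : ℝ)) ∈ interior (convexHull ℝ (latticePoints C)) := by
    rw [mem_interior_iff_mem_nhds]
    refine Filter.mem_of_superset (prod_mem_nhds (Icc_mem_nhds ?_ ?_) (Icc_mem_nhds ?_ ?_)) hsub
      <;> simp
  have hN1 : (0 : ℝ) < N - 1 := by linarith
  have := (convex_convexHull ℝ (latticePoints C)).combo_self_interior_mem_interior
    (subset_convexHull ℝ _ hp) hint (a := 1 - (r - 1) / (N - 1)) (b := (r - 1) / (N - 1))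
    (by rw [sub_nonneg, div_le_one hN1]; linarith) (div_pos (by linarith) hN1) (by ring)
  convert this using 1
  rw [smul_smul, ← add_smul]
  congr 1
  field_simp
  ring

theorem frontier_smul_of_ne_zero {r : ℝ} (hr : r ≠ 0) (s : Set (ℝ × ℝ)) :
    frontier (r • s) = r • frontier s :=
  ((Homeomorph.smulOfNeZero r hr).image_frontier s).symm

/-- After the boundaries of the first `k` dilates of the hull are removed, the convex hull of the
remaining integer points is the `(k+1)`-st dilate. -/
theorem convexHull_latticePoints_diff {C : Set (ℝ × ℝ)}
    (hadd : ∀ x ∈ C, ∀ y ∈ C, x + y ∈ C) (hsmul : ∀ c : ℝ, 0 ≤ c → ∀ x ∈ C, c • x ∈ C)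
    (hpos : ∃ c d, IsPosForm C c d)
    (hopen : ∀ m n : ℤ, ((m : ℝ), (n : ℝ)) ∈ latticePoints C → ∃ N₀ : ℕ, ∀ N ≥ N₀,
      ∀ i ∈ ({-1, 1} : Set ℤ), ∀ j ∈ ({-1, 1} : Set ℤ),
        (((N * m + i : ℤ) : ℝ), ((N * n + j : ℤ) : ℝ)) ∈ latticePoints C) (k : ℕ) :
    convexHull ℝ (latticePoints C \
        ⋃ j ∈ Set.Icc 1 k, (j : ℝ) • frontier (convexHull ℝ (latticePoints C))) =
      ((k + 1 : ℕ) : ℝ) • convexHull ℝ (latticePoints C) := by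
  have hk : (0 : ℝ) < ((k + 1 : ℕ) : ℝ) := by positivity
  apply Set.Subset.antisymm
  · refine convexHull_min ?_ ((convex_convexHull ℝ _).smul _)
    rintro p ⟨hp, hpu⟩
    obtain ⟨-, -, m, n, rfl⟩ := id hp
    obtain ⟨c, d, hcd, hmem⟩ := exists_isPosForm_inv_smul_mem_convexHull hadd hsmul hpos hp
    have ht := hcd m n hp
    have hcast : ((c * m + d * n : ℤ) : ℝ) = c * m + d * n := by push_cast; ring
    generalize c * m + d * n = t at ht hmem hcast
    lift t to ℕ using ht.le
    rw [Int.cast_natCast] at hmem hcast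
    have ht0 : (0 : ℝ) < t := by exact_mod_cast ht
    have hfr := mem_frontier_convexHull_latticePoints hcd hmem (by
      simp only [Prod.smul_mk, smul_eq_mul]
      field_simp
      exact hcast.symm)
    have hkt : k + 1 ≤ t := by
      by_contra! h
      refine hpu (Set.mem_biUnion (x := t) ⟨by omega, by omega⟩ ?_)
      rwa [Set.mem_smul_set_iff_inv_smul_mem₀ ht0.ne']
    rw [Set.mem_smul_set_iff_inv_smul_mem₀ hk.ne']
    have := smul_mem_convexHull_latticePoints hsmul (r := t / (k + 1 : ℕ))
      (by rw [one_le_div hk]; exact_mod_cast hkt) hmem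
    rw [smul_smul] at this
    convert this using 2
    field_simp
  · rw [← convexHull_smul]
    refine convexHull_mono ?_
    rintro _ ⟨p, hp, rfl⟩
    refine ⟨smul_mem_latticePoints hsmul (by omega) hp, ?_⟩
    simp only [Set.mem_iUnion, not_exists]
    rintro j ⟨hj1, hjk⟩ hj
    have hj0 : (0 : ℝ) < j := by exact_mod_cast hj1
    rw [Set.mem_smul_set_iff_inv_smul_mem₀ hj0.ne'] at hj
    refine hj.2 ?_
    simp only [smul_smul]
    refine smul_mem_interior_convexHull_latticePoints hopen hp ?_
    rw [inv_mul_eq_div, one_lt_div hj0]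
    exact_mod_cast Nat.lt_succ_of_le hjk

theorem sailAux_snd_eq_iUnion {C : Set (ℝ × ℝ)}
    (hadd : ∀ x ∈ C, ∀ y ∈ C, x + y ∈ C) (hsmul : ∀ c : ℝ, 0 ≤ c → ∀ x ∈ C, c • x ∈ C)
    (hpos : ∃ c d, IsPosForm C c d)
    (hopen : ∀ m n : ℤ, ((m : ℝ), (n : ℝ)) ∈ latticePoints C → ∃ N₀ : ℕ, ∀ N ≥ N₀,
      ∀ i ∈ ({-1, 1} : Set ℤ), ∀ j ∈ ({-1, 1} : Set ℤ),
        (((N * m + i : ℤ) : ℝ), ((N * n + j : ℤ) : ℝ)) ∈ latticePoints C) (k : ℕ) :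
    (sailAux C k).2 =
      ⋃ j ∈ Set.Icc 1 k, (j : ℝ) • frontier (convexHull ℝ (latticePoints C)) := by
  induction k with
  | zero => simp [sailAux]
  | succ k ih =>
    have hIcc : Set.Icc 1 (k + 1) = insert (k + 1) (Set.Icc 1 k) := by
      ext j
      simp only [Set.mem_Icc, Set.mem_insert_iff]
      omega
    rw [hIcc, Set.biUnion_insert, Set.union_comm]
    simp only [sailAux]
    rw [ih, convexHull_latticePoints_diff hadd hsmul hpos hopen,
      frontier_smul_of_ne_zero (by positivity)]

theorem ksail_succ {C : Set (ℝ × ℝ)}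
    (hadd : ∀ x ∈ C, ∀ y ∈ C, x + y ∈ C) (hsmul : ∀ c : ℝ, 0 ≤ c → ∀ x ∈ C, c • x ∈ C)
    (hpos : ∃ c d, IsPosForm C c d)
    (hopen : ∀ m n : ℤ, ((m : ℝ), (n : ℝ)) ∈ latticePoints C → ∃ N₀ : ℕ, ∀ N ≥ N₀,
      ∀ i ∈ ({-1, 1} : Set ℤ), ∀ j ∈ ({-1, 1} : Set ℤ),
        (((N * m + i : ℤ) : ℝ), ((N * n + j : ℤ) : ℝ)) ∈ latticePoints C) (k : ℕ) :
    ksail C (k + 1) = ((k + 1 : ℕ) : ℝ) • frontier (convexHull ℝ (latticePoints C)) := by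
  rw [← frontier_smul_of_ne_zero (by positivity),
    ← convexHull_latticePoints_diff hadd hsmul hpos hopen,
    ← sailAux_snd_eq_iUnion hadd hsmul hpos hopen]
  rfl

theorem pos_of_mul_sub_irrational_mul {α s : ℝ} (hα : Irrational α) (hs : s = 1 ∨ s = -1)
    {m n : ℤ} (h : 0 ≤ s * (m - α * n)) (h0 : ¬(m = 0 ∧ n = 0)) : 0 < s * (m - α * n) := by
  refine h.lt_of_ne' fun he => h0 ?_
  have he' : (m : ℝ) - α * n = 0 := by
    rcases hs with rfl | rfl <;> linarith
  have hn : n = 0 := by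
    by_contra hn
    refine hα ⟨m / n, ?_⟩
    have : (n : ℝ) ≠ 0 := by exact_mod_cast hn
    push_cast
    field_simp
    linarith
  subst hn
  exact ⟨by simpa using he', rfl⟩

theorem exists_isPosForm_eigenCone {α₁ α₂ s t : ℝ} (h₁ : Irrational α₁) (h₂ : Irrational α₂)
    (hne : α₁ ≠ α₂) (hs : s = 1 ∨ s = -1) (ht : t = 1 ∨ t = -1) :
    ∃ c d, IsPosForm (eigenCone α₁ α₂ s t) c d := by
  -- it suffices to find an integer form which is a positive combination of the bounding forms
  suffices h : ∃ c d : ℤ, ∃ u v : ℝ, 0 < u ∧ 0 < v ∧ u * s + v * t = c ∧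
      -(u * s * α₁ + v * t * α₂) = d by
    obtain ⟨c, d, u, v, hu, hv, hc, hd⟩ := h
    refine ⟨c, d, fun m n hmn => ?_⟩
    obtain ⟨⟨ha, hb⟩, h0⟩ := mk_mem_latticePoints.1 hmn
    have ha' := mul_pos hu (pos_of_mul_sub_irrational_mul h₁ hs ha h0)
    have hb' := mul_pos hv (pos_of_mul_sub_irrational_mul h₂ ht hb h0)
    have : (0 : ℝ) < c * m + d * n := by
      rw [← hc, ← hd]
      linarith
    exact_mod_cast this
  have key : ∀ β γ : ℝ, β < γ → ∀ σ : ℤ, ∃ c d : ℤ, ∃ u v : ℝ, 0 < u ∧ 0 < v ∧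
      u * σ + v * σ = c ∧ -(u * σ * β + v * σ * γ) = d := by
    intro β γ h σ
    obtain ⟨q, hq, hq'⟩ := exists_rat_btwn h
    have hden : (0 : ℝ) < q.den := by exact_mod_cast q.den_pos
    have hgap : (0 : ℝ) < γ - β := sub_pos.2 h
    have hnum : (q.num : ℝ) = q * q.den := by exact_mod_cast (Rat.mul_den_eq_num q).symm
    refine ⟨σ * q.den, -(σ * q.num), q.den * (γ - q) / (γ - β), q.den * (q - β) / (γ - β),
      div_pos (mul_pos hden (sub_pos.2 hq')) hgap, div_pos (mul_pos hden (sub_pos.2 hq)) hgap,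
      ?_, ?_⟩
    · push_cast
      field_simp
      ring
    · push_cast
      rw [hnum]
      field_simp
      ring
  obtain ⟨σ, hσ⟩ : ∃ σ : ℤ, (σ : ℝ) = s := by
    rcases hs with rfl | rfl
    exacts [⟨1, by simp⟩, ⟨-1, by simp⟩]
  by_cases hst : t = s
  · subst hst hσ
    rcases hne.lt_or_gt with h | h
    · exact key _ _ h σ
    · obtain ⟨c, d, u, v, hu, hv, hc, hd⟩ := key _ _ h σ
      exact ⟨c, d, v, u, hv, hu, by linarith, by linarith⟩
  · have hts : t = -s := by
      rcases hs with rfl | rfl <;> rcases ht with rfl | rfl <;> simp_all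
    subst hts
    rcases hne.lt_or_gt with h | h
    · have h' : α₂ - α₁ ≠ 0 := by linarith
      refine ⟨0, σ, (α₂ - α₁)⁻¹, (α₂ - α₁)⁻¹, inv_pos.2 (by linarith), inv_pos.2 (by linarith),
        by simp, ?_⟩
      rw [hσ]
      field_simp
      ring
    · have h' : α₁ - α₂ ≠ 0 := by linarith
      refine ⟨0, -σ, (α₁ - α₂)⁻¹, (α₁ - α₂)⁻¹, inv_pos.2 (by linarith), inv_pos.2 (by linarith),
        by simp, ?_⟩
      push_cast
      rw [hσ]
      field_simp
      ring

theorem eventually_eigenCone_neighbours {α s : ℝ} (hα : Irrational α) (hs : s = 1 ∨ s = -1)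
    {m n : ℤ} (h : 0 ≤ s * (m - α * n)) (h0 : ¬(m = 0 ∧ n = 0)) :
    ∀ᶠ N : ℕ in Filter.atTop, ∀ i ∈ ({-1, 1} : Set ℤ), ∀ j ∈ ({-1, 1} : Set ℤ),
      0 < s * (((N * m + i : ℤ) : ℝ) - α * ((N * n + j : ℤ) : ℝ)) := by
  have hpos := pos_of_mul_sub_irrational_mul hα hs h h0
  have hlim : Filter.Tendsto (fun N : ℕ => (N : ℝ) * (s * (m - α * n))) Filter.atTop
      Filter.atTop := tendsto_natCast_atTop_atTop.atTop_mul_const hpos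
  filter_upwards [hlim.eventually_gt_atTop (1 + |α|)] with N hN i hi j hj
  have h1 := neg_abs_le α
  have h2 := le_abs_self α
  push_cast
  rcases hs with rfl | rfl <;> rcases hi with rfl | rfl <;> rcases hj with rfl | rfl <;>
    push_cast <;> linarith

theorem eigenCone_neighbours_mem {α₁ α₂ s t : ℝ} (h₁ : Irrational α₁) (h₂ : Irrational α₂)
    (hs : s = 1 ∨ s = -1) (ht : t = 1 ∨ t = -1) (m n : ℤ)
    (h : ((m : ℝ), (n : ℝ)) ∈ latticePoints (eigenCone α₁ α₂ s t)) :
    ∃ N₀ : ℕ, ∀ N ≥ N₀, ∀ i ∈ ({-1, 1} : Set ℤ), ∀ j ∈ ({-1, 1} : Set ℤ),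
      (((N * m + i : ℤ) : ℝ), ((N * n + j : ℤ) : ℝ)) ∈
        latticePoints (eigenCone α₁ α₂ s t) := by
  obtain ⟨⟨ha, hb⟩, h0⟩ := mk_mem_latticePoints.1 h
  obtain ⟨N₀, hN₀⟩ := Filter.eventually_atTop.1 ((eventually_eigenCone_neighbours h₁ hs ha h0).and
    (eventually_eigenCone_neighbours h₂ ht hb h0))
  refine ⟨N₀, fun N hN i hi j hj => ?_⟩
  have hA := (hN₀ N hN).1 i hi j hj
  refine mk_mem_latticePoints.2 ⟨⟨hA.le, ((hN₀ N hN).2 i hi j hj).le⟩, fun ⟨hm, hn⟩ => ?_⟩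
  rw [hm, hn] at hA
  simp at hA

theorem add_mem_eigenCone {α₁ α₂ s t : ℝ} :
    ∀ x ∈ eigenCone α₁ α₂ s t, ∀ y ∈ eigenCone α₁ α₂ s t, x + y ∈ eigenCone α₁ α₂ s t := by
  rintro x ⟨hx₁, hx₂⟩ y ⟨hy₁, hy₂⟩
  constructor <;> simp only [Prod.fst_add, Prod.snd_add] <;> linarith

theorem smul_mem_eigenCone {α₁ α₂ s t : ℝ} :
    ∀ c : ℝ, 0 ≤ c → ∀ x ∈ eigenCone α₁ α₂ s t, c • x ∈ eigenCone α₁ α₂ s t := by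
  rintro c hc x ⟨hx₁, hx₂⟩
  have h₁ := mul_nonneg hc hx₁
  have h₂ := mul_nonneg hc hx₂
  constructor <;> simp only [Prod.smul_fst, Prod.smul_snd, smul_eq_mul] <;> linarith

/-- Proposition: for an algebraic 2-dimensional MCRS-group, the `k`-sail of any
of its four cones is homothetic (centered at the origin) to the `1`-sail of the
same cone, with homothety coefficient `k`. -/
theorem ksail_homothetic (α₁ α₂ : ℝ)
    (h₁ : Irrational α₁) (h₂ : Irrational α₂) (hne : α₁ ≠ α₂)
    (halg : IsAlgebraicPair α₁ α₂) :
    ∀ s t : ℝ, (s = 1 ∨ s = -1) → (t = 1 ∨ t = -1) →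
      ∀ k : ℕ, 1 ≤ k →
        ksail (eigenCone α₁ α₂ s t) k = (k : ℝ) • ksail (eigenCone α₁ α₂ s t) 1 := by
  intro s t hs ht k hk
  have hksail := ksail_succ add_mem_eigenCone smul_mem_eigenCone
    (exists_isPosForm_eigenCone h₁ h₂ hne hs ht) (eigenCone_neighbours_mem h₁ h₂ hs ht)
  obtain ⟨k, rfl⟩ := Nat.exists_eq_add_of_le' hk
  rw [hksail k, hksail 0]
  simp
end

section
/- Let A be an algebraic hyperbolic 2-dimensional MCRS-group with eigenlines y = α₁x, y = α₂x (α₁ ≠ α₂ irrational quadratic). There exists a constant C > 0 such that for every positive integer N, if the best approximation A_N of size at most N is defined by primitive integer vectors v₁ and v₂, then |Φ_A(v₁)| ≤ C and |Φ_A(v₂)| ≤ C; consequently v₁, v₂ lie on k₁- and k₂-geometric continued fractions with k₁, k₂ < C/α where α is the Markoff minimum of Φ_A. -/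
/-- Coefficients of the Markoff-Davenport form of the MCRS-group whose
eigenlines are spanned by `(p₁,q₁)` and `(p₂,q₂)`. -/
noncomputable def mdCoeffs (p₁ q₁ p₂ q₂ : ℝ) : ℝ × ℝ × ℝ :=
  (q₁ * q₂ / (p₁ * q₂ - p₂ * q₁),
   -(q₁ * p₂ + q₂ * p₁) / (p₁ * q₂ - p₂ * q₁),
   p₁ * p₂ / (p₁ * q₂ - p₂ * q₁))

/-- Discrepancy: minimum over `Φ_A ± Φ_B` of the maximal absolute value of
the coefficients. -/
noncomputable def discrepancy (c d : ℝ × ℝ × ℝ) : ℝ :=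
  min (max |c.1 - d.1| (max |c.2.1 - d.2.1| |c.2.2 - d.2.2|))
      (max |c.1 + d.1| (max |c.2.1 + d.2.1| |c.2.2 + d.2.2|))

/-- A rational MCRS-group of size at most `N`, given by primitive integer
vectors `v`, `w` spanning its two distinct eigenlines. -/
def IsRationalOfSize (N : ℕ) (v w : ℤ × ℤ) : Prop :=
  Int.gcd v.1 v.2 = 1 ∧ Int.gcd w.1 w.2 = 1 ∧
  v.1 * w.2 - w.1 * v.2 ≠ 0 ∧
  max (max v.1.natAbs v.2.natAbs) (max w.1.natAbs w.2.natAbs) ≤ N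

/-- Discrepancy between the group with eigenlines `x = α₁y`, `x = α₂y` and the
rational group spanned by `v`, `w`. -/
noncomputable def rho (α₁ α₂ : ℝ) (v w : ℤ × ℤ) : ℝ :=
  discrepancy (mdCoeffs α₁ 1 α₂ 1) (mdCoeffs v.1 v.2 w.1 w.2)

/-- `α` is a quadratic irrationality. -/
def IsQuadraticIrrational (α : ℝ) : Prop :=
  Irrational α ∧ ∃ a b c : ℤ, a ≠ 0 ∧ (a : ℝ) * α ^ 2 + b * α + c = 0

/-- A binary quadratic form with coefficients `c`. -/
def quadForm (c : ℝ × ℝ × ℝ) (x y : ℝ) : ℝ :=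
  c.1 * x ^ 2 + c.2.1 * (x * y) + c.2.2 * y ^ 2

theorem abs_quadForm_le {c : ℝ × ℝ × ℝ} {e N x y : ℝ}
    (h : max |c.1| (max |c.2.1| |c.2.2|) ≤ e) (hx : |x| ≤ N) (hy : |y| ≤ N) :
    |quadForm c x y| ≤ 3 * (e * N ^ 2) := by
  obtain ⟨h1, h'⟩ := max_le_iff.1 h
  obtain ⟨h2, h3⟩ := max_le_iff.1 h'
  have he : 0 ≤ e := (abs_nonneg _).trans h1
  have hN : 0 ≤ N := (abs_nonneg _).trans hx
  have b1 : |c.1 * x ^ 2| ≤ e * N ^ 2 := by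
    rw [abs_mul, abs_pow]; gcongr
  have b2 : |c.2.1 * (x * y)| ≤ e * N ^ 2 := by
    rw [abs_mul, abs_mul, pow_two]; gcongr
  have b3 : |c.2.2 * y ^ 2| ≤ e * N ^ 2 := by
    rw [abs_mul, abs_pow]; gcongr
  unfold quadForm
  calc _ ≤ |c.1 * x ^ 2| + |c.2.1 * (x * y)| + |c.2.2 * y ^ 2| := abs_add_three _ _ _
    _ ≤ _ := by linarith

theorem abs_quadForm_le_discrepancy {c d : ℝ × ℝ × ℝ} {N x y : ℝ}
    (hd : quadForm d x y = 0) (hx : |x| ≤ N) (hy : |y| ≤ N) :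
    |quadForm c x y| ≤ 3 * (discrepancy c d * N ^ 2) := by
  unfold discrepancy
  rcases min_choice (max |c.1 - d.1| (max |c.2.1 - d.2.1| |c.2.2 - d.2.2|))
      (max |c.1 + d.1| (max |c.2.1 + d.2.1| |c.2.2 + d.2.2|)) with h | h <;> rw [h]
  · have := abs_quadForm_le (c := (c.1 - d.1, c.2.1 - d.2.1, c.2.2 - d.2.2)) le_rfl hx hy
    convert this using 2
    unfold quadForm at *
    linear_combination hd
  · have := abs_quadForm_le (c := (c.1 + d.1, c.2.1 + d.2.1, c.2.2 + d.2.2)) le_rfl hx hy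
    convert this using 2
    unfold quadForm at *
    linear_combination -hd

theorem quadForm_mdCoeffs (p₁ q₁ p₂ q₂ x y : ℝ) :
    quadForm (mdCoeffs p₁ q₁ p₂ q₂) x y =
      (q₁ * x - p₁ * y) * (q₂ * x - p₂ * y) / (p₁ * q₂ - p₂ * q₁) := by
  unfold quadForm mdCoeffs
  ring

theorem quadForm_mdCoeffs_eq_mdForm (α₁ α₂ x y : ℝ) :
    quadForm (mdCoeffs α₁ 1 α₂ 1) x y = mdForm α₁ α₂ x y := by
  rw [quadForm_mdCoeffs]
  simp [mdForm]

theorem IsRationalOfSize.abs_le {N : ℕ} {v w : ℤ × ℤ} (h : IsRationalOfSize N v w) :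
    (|(v.1 : ℝ)| ≤ N ∧ |(v.2 : ℝ)| ≤ N) ∧ |(w.1 : ℝ)| ≤ N ∧ |(w.2 : ℝ)| ≤ N := by
  obtain ⟨-, -, -, h⟩ := h
  simp only [max_le_iff] at h
  have key : ∀ z : ℤ, z.natAbs ≤ N → |(z : ℝ)| ≤ N := fun z hz => by
    rw [← Int.cast_abs, Int.abs_eq_natAbs]
    exact_mod_cast hz
  exact ⟨⟨key _ h.1.1, key _ h.1.2⟩, key _ h.2.1, key _ h.2.2⟩

/-- The eigenvalue equations make the product of the two linear forms integral on `ℤ²`, up to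
a nonzero integral factor. -/
theorem IsAlgebraicPair.exists_int {α₁ α₂ : ℝ} (halg : IsAlgebraicPair α₁ α₂) :
    ∃ c : ℤ, c ≠ 0 ∧ ∀ p q : ℤ, ∃ n : ℤ,
      (c : ℝ) * ((p - α₁ * q) * (p - α₂ * q)) = n := by
  obtain ⟨g, -, lam, mu, hne, e₁, e₂⟩ := halg
  have a1 := congrFun e₁ 0
  have a2 := congrFun e₁ 1
  have b1 := congrFun e₂ 0
  have b2 := congrFun e₂ 1
  simp [Matrix.mulVec, dotProduct, Fin.sum_univ_two] at a1 a2 b1 b2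
  have hα : α₁ ≠ α₂ := by
    rintro rfl
    exact hne (a2.symm.trans b2)
  have hsum : (g 1 0 : ℝ) * (α₁ + α₂) = g 0 0 - g 1 1 := by
    apply mul_left_cancel₀ (sub_ne_zero.2 hα)
    linear_combination α₁ * a2 - a1 - (α₂ * b2 - b1)
  refine ⟨g 1 0, ?_, fun p q =>
    ⟨g 1 0 * p ^ 2 - (g 0 0 - g 1 1) * p * q - g 0 1 * q ^ 2, ?_⟩⟩
  · intro h
    rw [h] at a2 b2
    apply hne
    simp at a2 b2
    rw [← a2, ← b2]
  · push_cast
    linear_combination (α₁ * q ^ 2 - p * q) * hsum - (q : ℝ) ^ 2 * (α₁ * a2 - a1)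

theorem Irrational.sub_mul_ne_zero {α : ℝ} (h : Irrational α) {p q : ℤ}
    (hpq : ¬(p = 0 ∧ q = 0)) : (p : ℝ) - α * q ≠ 0 := by
  intro h0
  by_cases hq : q = 0
  · subst hq
    simp at h0
    exact hpq ⟨h0, rfl⟩
  · apply h
    refine ⟨p / q, ?_⟩
    have : (q : ℝ) ≠ 0 := by exact_mod_cast hq
    push_cast
    field_simp
    linarith

theorem one_le_abs_of_eq_intCast {x : ℝ} {n : ℤ} (h : x = n) (hx : x ≠ 0) : 1 ≤ |x| := by
  rw [h] at hx ⊢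
  exact_mod_cast Int.one_le_abs (by exact_mod_cast hx)

/-- The points of a cone `eigenCone α₁ α₂ s t` above a level line of the Markoff-Davenport
form. -/
def coneLevel (α₁ α₂ s t b : ℝ) : Set (ℝ × ℝ) :=
  {v | 0 ≤ s * (v.1 - α₁ * v.2) ∧ 0 ≤ t * (v.1 - α₂ * v.2) ∧
    b ≤ (s * (v.1 - α₁ * v.2)) * (t * (v.1 - α₂ * v.2))}

theorem isClosed_coneLevel (α₁ α₂ s t b : ℝ) : IsClosed (coneLevel α₁ α₂ s t b) := by
  have h (u α : ℝ) : Continuous fun v : ℝ × ℝ => u * (v.1 - α * v.2) := by fun_prop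
  exact (isClosed_le continuous_const (h s α₁)).inter
    ((isClosed_le continuous_const (h t α₂)).inter
      (isClosed_le continuous_const ((h s α₁).mul (h t α₂))))

theorem le_mul_convexComb {x y x' y' b m n : ℝ} (hx : 0 ≤ x) (hy : 0 ≤ y) (hx' : 0 ≤ x')
    (hy' : 0 ≤ y') (hb : 0 ≤ b) (h : b ≤ x * y) (h' : b ≤ x' * y') (hm : 0 ≤ m) (hn : 0 ≤ n)
    (hmn : m + n = 1) : b ≤ (m * x + n * x') * (m * y + n * y') := by
  have h1 : 2 * b ≤ x * y' + x' * y := by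
    apply abs_le_of_sq_le_sq' _ (by positivity) |>.2
    have := mul_le_mul h h' hb (by positivity)
    nlinarith [sq_nonneg (x * y' - x' * y)]
  have e : b = m ^ 2 * b + n ^ 2 * b + m * n * (2 * b) := by
    linear_combination (-(m + n + 1) * b) * hmn
  have k1 := mul_le_mul_of_nonneg_left h (sq_nonneg m)
  have k2 := mul_le_mul_of_nonneg_left h' (sq_nonneg n)
  have k3 := mul_le_mul_of_nonneg_left h1 (mul_nonneg hm hn)
  nlinarith

theorem convex_coneLevel (α₁ α₂ s t : ℝ) {b : ℝ} (hb : 0 ≤ b) :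
    Convex ℝ (coneLevel α₁ α₂ s t b) := by
  rintro ⟨x, y⟩ ⟨h1, h2, h3⟩ ⟨x', y'⟩ ⟨h1', h2', h3'⟩ m n hm hn hmn
  have key := le_mul_convexComb h1 h2 h1' h2' hb h3 h3' hm hn hmn
  have e : ∀ u α : ℝ, u * ((m • (x, y) + n • (x', y')).1 - α * (m • (x, y) + n • (x', y')).2)
      = m * (u * (x - α * y)) + n * (u * (x' - α * y')) := fun u α => by
    simp
    ring
  refine ⟨?_, ?_, ?_⟩
  · rw [e]
    exact add_nonneg (mul_nonneg hm h1) (mul_nonneg hn h1')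
  · rw [e]
    exact add_nonneg (mul_nonneg hm h2) (mul_nonneg hn h2')
  · rw [e, e]
    exact key

/-- The form exceeds the level strictly in the interior of a region above a positive level. -/
theorem lt_of_mem_interior {α₁ α₂ s t b : ℝ} (hb : 0 < b) {S : Set (ℝ × ℝ)}
    (hS : S ⊆ coneLevel α₁ α₂ s t b) {v : ℝ × ℝ} (hv : v ∈ interior S) :
    b < (s * (v.1 - α₁ * v.2)) * (t * (v.1 - α₂ * v.2)) := by
  have hcont : Filter.Tendsto (fun r : ℝ => r • v) (nhdsWithin 1 (Set.Iio 1)) (nhds v) := by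
    have : Continuous (fun r : ℝ => r • v) := by fun_prop
    simpa using (this.tendsto 1).mono_left nhdsWithin_le_nhds
  have hpos : ∀ᶠ r : ℝ in nhdsWithin 1 (Set.Iio 1), 0 < r :=
    nhdsWithin_le_nhds (lt_mem_nhds one_pos)
  obtain ⟨r, ⟨hr, hr1⟩, hr0⟩ := ((hcont.eventually (isOpen_interior.mem_nhds hv)).and
    self_mem_nhdsWithin |>.and hpos).exists
  have hr1 : r < 1 := hr1
  have h := (hS (interior_subset hr)).2.2
  have e : (s * ((r • v).1 - α₁ * (r • v).2)) * (t * ((r • v).1 - α₂ * (r • v).2))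
      = r ^ 2 * ((s * (v.1 - α₁ * v.2)) * (t * (v.1 - α₂ * v.2))) := by
    simp
    ring
  rw [e] at h
  have h0 := hS (interior_subset hv)
  have hr2 : r ^ 2 < 1 := by nlinarith
  nlinarith [h0.2.2]

theorem latticePoints_diff_subset {α₁ α₂ s t : ℝ} (h₁ : Irrational α₁) (h₂ : Irrational α₂)
    {c : ℤ} (hc : c ≠ 0) (hint : ∀ p q : ℤ, ∃ n : ℤ,
      (c : ℝ) * ((p - α₁ * q) * (p - α₂ * q)) = n)
    (hs : s = 1 ∨ s = -1) (ht : t = 1 ∨ t = -1) (k : ℕ) :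
    latticePoints (eigenCone α₁ α₂ s t) \ (sailAux (eigenCone α₁ α₂ s t) k).2 ⊆
      coneLevel α₁ α₂ s t ((k + 1 : ℕ) / |(c : ℝ)|) := by
  have hc' : 0 < |(c : ℝ)| := abs_pos.2 (by exact_mod_cast hc)
  have hst : |s * t| = 1 := by rcases hs with rfl | rfl <;> rcases ht with rfl | rfl <;> simp
  have hstrict : ∀ v ∈ latticePoints (eigenCone α₁ α₂ s t), ∀ k : ℕ,
      k / |(c : ℝ)| < (s * (v.1 - α₁ * v.2)) * (t * (v.1 - α₂ * v.2)) →
      v ∈ coneLevel α₁ α₂ s t ((k + 1 : ℕ) / |(c : ℝ)|) := by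
    rintro v ⟨⟨hv1, hv2⟩, -, p, q, rfl⟩ k hk
    refine ⟨hv1, hv2, ?_⟩
    obtain ⟨n, hn⟩ := hint p q
    have e : (s * ((p : ℝ) - α₁ * q)) * (t * ((p : ℝ) - α₂ * q)) * |(c : ℝ)| = |(n : ℝ)| := by
      rw [← hn, abs_mul, mul_comm, ← abs_of_nonneg (mul_nonneg hv1 hv2)]
      congr 1
      rw [mul_mul_mul_comm, abs_mul, hst, one_mul]
    dsimp only at hk ⊢
    rw [div_lt_iff₀ hc', e] at hk
    rw [div_le_iff₀ hc', e]
    have : (k : ℤ) < |n| := by exact_mod_cast hk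
    exact_mod_cast Int.add_one_le_iff.2 this
  induction k with
  | zero =>
    rintro v ⟨hv, -⟩
    apply hstrict v hv
    obtain ⟨⟨hv1, hv2⟩, hv0, p, q, rfl⟩ := hv
    have hpq : ¬(p = 0 ∧ q = 0) := by
      rintro ⟨rfl, rfl⟩
      exact hv0 (by simp)
    have hs0 : s ≠ 0 := by rcases hs with rfl | rfl <;> norm_num
    have ht0 : t ≠ 0 := by rcases ht with rfl | rfl <;> norm_num
    have l1 := lt_of_le_of_ne hv1 (mul_ne_zero hs0 (h₁.sub_mul_ne_zero hpq)).symm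
    have l2 := lt_of_le_of_ne hv2 (mul_ne_zero ht0 (h₂.sub_mul_ne_zero hpq)).symm
    simpa using mul_pos l1 l2
  | succ k ih =>
    rintro v ⟨hv, hnot⟩
    simp only [sailAux, Set.mem_union, not_or] at hnot
    apply hstrict v hv
    have hb : (0 : ℝ) < (k + 1 : ℕ) / |(c : ℝ)| := by positivity
    refine lt_of_mem_interior hb (convexHull_min ih (convex_coneLevel _ _ _ _ hb.le)) ?_
    by_contra hi
    exact hnot.2 ⟨subset_closure (subset_convexHull ℝ _ ⟨hv, hnot.1⟩), hi⟩

theorem ksail_subset {α₁ α₂ s t : ℝ} (h₁ : Irrational α₁) (h₂ : Irrational α₂)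
    {c : ℤ} (hc : c ≠ 0) (hint : ∀ p q : ℤ, ∃ n : ℤ,
      (c : ℝ) * ((p - α₁ * q) * (p - α₂ * q)) = n)
    (hs : s = 1 ∨ s = -1) (ht : t = 1 ∨ t = -1) (k : ℕ) :
    ksail (eigenCone α₁ α₂ s t) k ⊆ coneLevel α₁ α₂ s t (k / |(c : ℝ)|) := by
  cases k with
  | zero => simp [ksail, sailAux]
  | succ k =>
    intro v hv
    have hb : (0 : ℝ) ≤ (k + 1 : ℕ) / |(c : ℝ)| := by positivity
    exact closure_minimal (convexHull_min (latticePoints_diff_subset h₁ h₂ hc hint hs ht k)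
      (convex_coneLevel _ _ _ _ hb)) (isClosed_coneLevel _ _ _ _ _) hv.1

theorem le_abs_of_mem_coneLevel {α₁ α₂ s t b : ℝ} (hs : s = 1 ∨ s = -1) (ht : t = 1 ∨ t = -1)
    {v : ℝ × ℝ} (h : v ∈ coneLevel α₁ α₂ s t b) :
    b ≤ |(v.1 - α₁ * v.2) * (v.1 - α₂ * v.2)| := by
  have hst : |s * t| = 1 := by rcases hs with rfl | rfl <;> rcases ht with rfl | rfl <;> simp
  refine h.2.2.trans ((le_abs_self _).trans ?_)
  rw [mul_mul_mul_comm, abs_mul, hst, one_mul]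

theorem le_of_mem_geomCF {α₁ α₂ : ℝ} (h₁ : Irrational α₁) (h₂ : Irrational α₂)
    {c : ℤ} (hc : c ≠ 0) (hint : ∀ p q : ℤ, ∃ n : ℤ,
      (c : ℝ) * ((p - α₁ * q) * (p - α₂ * q)) = n) {k : ℕ} {v : ℝ × ℝ}
    (hv : v ∈ geomCF α₁ α₂ k) :
    k / |(c : ℝ)| ≤ |(v.1 - α₁ * v.2) * (v.1 - α₂ * v.2)| := by
  have key : ∀ s t : ℝ, (s = 1 ∨ s = -1) → (t = 1 ∨ t = -1) →
      v ∈ ksail (eigenCone α₁ α₂ s t) k →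
      k / |(c : ℝ)| ≤ |(v.1 - α₁ * v.2) * (v.1 - α₂ * v.2)| := fun s t hs ht h =>
    le_abs_of_mem_coneLevel hs ht (ksail_subset h₁ h₂ hc hint hs ht k h)
  rcases hv with ((hv | hv) | hv) | hv
  · exact key _ _ (.inl rfl) (.inl rfl) hv
  · exact key _ _ (.inl rfl) (.inr rfl) hv
  · exact key _ _ (.inr rfl) (.inl rfl) hv
  · exact key _ _ (.inr rfl) (.inr rfl) hv

/-- A badly approximable number has rational approximations of height at most `N` and error
`O(1/N²)`. -/
theorem exists_rat_approx {α β B : ℝ}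
    (hbad : ∀ p q : ℤ, ¬(p = 0 ∧ q = 0) → 1 ≤ B * |(p - α * q) * (p - β * q)|) :
    ∃ K : ℝ, ∃ N₀ : ℕ, 0 < K ∧ ∀ N : ℕ, N₀ ≤ N → 0 < N →
      ∃ r : ℚ, r.num.natAbs ≤ N ∧ r.den ≤ N ∧ |α - r| ≤ K / (N : ℝ) ^ 2 := by
  have hB : 0 < B := by
    by_contra! h
    have := hbad 1 0 (by simp)
    simp at this
    linarith
  obtain ⟨M, hM⟩ := exists_nat_ge (|α| + 1)
  have hM1 : (1 : ℝ) ≤ M := by linarith [abs_nonneg α]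
  have hM0 : 0 < M := by exact_mod_cast (one_pos.trans_le hM1)
  refine ⟨B * (1 + |α - β|) * M ^ 2, M, by positivity, fun N hN hNpos => ?_⟩
  have hNr : (0 : ℝ) < N := by exact_mod_cast hNpos
  have hn : 0 < N / M := Nat.div_pos hN hM0
  obtain ⟨r, hr, hden⟩ := Real.exists_rat_abs_sub_le_and_den_le α hn
  have hNM : (N : ℝ) ≤ M * ((N / M : ℕ) + 1) := by
    exact_mod_cast (Nat.lt_mul_div_succ N hM0).le
  have hMN : (M : ℝ) * (N / M : ℕ) ≤ N := by exact_mod_cast Nat.mul_div_le N M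
  have hq : (0 : ℝ) < r.den := by exact_mod_cast r.den_pos
  have hq1 : (1 : ℝ) ≤ r.den := by exact_mod_cast r.den_pos
  have hdenr : (r.den : ℝ) ≤ (N / M : ℕ) := by exact_mod_cast hden
  have hrq : (r : ℝ) * r.den = r.num := by exact_mod_cast Rat.mul_den_eq_num r
  have hn0 : (0 : ℝ) < (N / M : ℕ) := by exact_mod_cast hn
  have hlin : |(r.num : ℝ) - α * r.den| = |α - r| * r.den := by
    rw [← hrq, ← sub_mul, abs_mul, abs_of_pos hq, abs_sub_comm]
  have hlin1 : |(r.num : ℝ) - α * r.den| ≤ 1 / ((N / M : ℕ) + 1) := by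
    rw [hlin, ← le_div_iff₀ hq, div_div]
    exact hr
  have hlin2 : |(r.num : ℝ) - α * r.den| ≤ M / N := by
    refine hlin1.trans ?_
    rw [div_le_div_iff₀ (by positivity) hNr]
    linarith
  have hlin3 : |(r.num : ℝ) - α * r.den| ≤ 1 := by
    refine hlin1.trans ?_
    rw [div_le_one (by positivity)]
    linarith
  have hnum : |(r.num : ℝ)| ≤ N := by
    calc |(r.num : ℝ)| = |((r.num : ℝ) - α * r.den) + α * r.den| := by ring_nf
      _ ≤ |(r.num : ℝ) - α * r.den| + |α * r.den| := abs_add_le _ _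
      _ ≤ r.den + |α| * r.den := by
        rw [abs_mul, abs_of_pos hq]
        linarith
      _ = (|α| + 1) * r.den := by ring
      _ ≤ M * (N / M : ℕ) := by gcongr
      _ ≤ N := hMN
  have hother : |(r.num : ℝ) - β * r.den| ≤ (1 + |α - β|) * r.den := by
    calc |(r.num : ℝ) - β * r.den|
        = |((r.num : ℝ) - α * r.den) + (α - β) * r.den| := by ring_nf
      _ ≤ |(r.num : ℝ) - α * r.den| + |(α - β) * r.den| := abs_add_le _ _
      _ ≤ r.den + |α - β| * r.den := by
        rw [abs_mul, abs_of_pos hq]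
        linarith
      _ = _ := by ring
  refine ⟨r, ?_, hden.trans (Nat.div_le_self N M), ?_⟩
  · rw [← Int.cast_abs, Int.abs_eq_natAbs] at hnum
    exact_mod_cast hnum
  · have h1 := hbad r.num r.den (by
      rintro ⟨-, h⟩
      exact r.den_nz (by exact_mod_cast h))
    rw [Int.cast_natCast, abs_mul] at h1
    have h2 : 1 ≤ B * (1 + |α - β|) * M / N * r.den := by
      calc (1 : ℝ) ≤ B * (|(r.num : ℝ) - α * r.den| * |(r.num : ℝ) - β * r.den|) := h1
        _ ≤ B * (M / N * ((1 + |α - β|) * r.den)) := by gcongr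
        _ = _ := by ring
    have h3 : |α - r| * r.den ≤ M / N := hlin ▸ hlin2
    refine le_of_mul_le_mul_right ?_ hq
    calc |α - r| * r.den ≤ M / N * 1 := by linarith
      _ ≤ M / N * (B * (1 + |α - β|) * M / N * r.den) := by gcongr
      _ = _ := by
        field_simp

theorem abs_div_sub_div_le {x x' d d' A e : ℝ} (hd : d ≠ 0) (hx : |x - x'| ≤ A * e)
    (hdd : |d - d'| ≤ 2 * e) (he : e ≤ |d| / 4) :
    |x / d - x' / d'| ≤ (A * |d| + 2 * |x|) * (2 / |d| ^ 2) * e := by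
  have hdpos : 0 < |d| := abs_pos.2 hd
  have hd' : |d| / 2 ≤ |d'| := by
    have := abs_sub_abs_le_abs_sub d d'
    linarith
  have hd'pos : 0 < |d'| := by linarith
  have hd'0 : d' ≠ 0 := abs_pos.1 hd'pos
  have e1 : x / d - x' / d' = ((x - x') * d - x * (d - d')) / (d * d') := by
    field_simp
    ring
  have hnum : |(x - x') * d - x * (d - d')| ≤ (A * |d| + 2 * |x|) * e := by
    calc _ ≤ |(x - x') * d| + |x * (d - d')| := abs_sub _ _
      _ = |x - x'| * |d| + |x| * |d - d'| := by rw [abs_mul, abs_mul]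
      _ ≤ A * e * |d| + |x| * (2 * e) := by gcongr
      _ = _ := by ring
  have h0 := (abs_nonneg _).trans hnum
  rw [e1, abs_div, abs_mul]
  calc _ ≤ (A * |d| + 2 * |x|) * e / (|d| * (|d| / 2)) := by gcongr
    _ = _ := by
      field_simp

theorem mdCoeffs_num_den (r₁ r₂ : ℚ) :
    mdCoeffs r₁.num r₁.den r₂.num r₂.den = mdCoeffs r₁ 1 r₂ 1 := by
  have h₁ : (r₁.den : ℝ) ≠ 0 := by exact_mod_cast r₁.den_nz
  have h₂ : (r₂.den : ℝ) ≠ 0 := by exact_mod_cast r₂.den_nz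
  have e₁ : (r₁.num : ℝ) = r₁ * r₁.den := by exact_mod_cast (Rat.mul_den_eq_num r₁).symm
  have e₂ : (r₂.num : ℝ) = r₂ * r₂.den := by exact_mod_cast (Rat.mul_den_eq_num r₂).symm
  have hd : (r₁.num : ℝ) * r₂.den - r₂.num * r₁.den = (r₁.den * r₂.den) * (r₁ - r₂) := by
    rw [e₁, e₂]
    ring
  have hm : (r₁.den * r₂.den : ℝ) ≠ 0 := mul_ne_zero h₁ h₂
  unfold mdCoeffs
  rw [hd]
  simp only [mul_one, one_mul]
  rw [Prod.mk.injEq, Prod.mk.injEq]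
  refine ⟨?_, ?_, ?_⟩
  · rw [← mul_div_mul_left (1 : ℝ) _ hm, mul_one]
  · rw [← mul_div_mul_left (-((r₂ : ℝ) + r₁)) _ hm, e₁, e₂]
    ring
  · rw [← mul_div_mul_left ((r₁ : ℝ) * r₂) _ hm, e₁, e₂]
    ring

/-- The coefficients of the Markoff-Davenport form depend on the eigenlines in a Lipschitz way. -/
theorem exists_discrepancy_le {α₁ α₂ : ℝ} (hne : α₁ ≠ α₂) :
    ∃ C : ℝ, 0 < C ∧ ∀ r₁ r₂ e : ℝ, |α₁ - r₁| ≤ e → |α₂ - r₂| ≤ e → e ≤ 1 →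
      e ≤ |α₁ - α₂| / 4 →
      discrepancy (mdCoeffs α₁ 1 α₂ 1) (mdCoeffs r₁ 1 r₂ 1) ≤ C * e := by
  have hd : α₁ - α₂ ≠ 0 := sub_ne_zero.2 hne
  have hdpos : 0 < |α₁ - α₂| := abs_pos.2 hd
  set D := 2 / |α₁ - α₂| ^ 2 with hD
  have hDpos : 0 < D := by positivity
  set C₁ := (0 * |α₁ - α₂| + 2 * |(1 : ℝ)|) * D
  set C₂ := (2 * |α₁ - α₂| + 2 * |-(α₂ + α₁)|) * D
  set C₃ := ((|α₁| + |α₂| + 1) * |α₁ - α₂| + 2 * |α₁ * α₂|) * D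
  have p1 : 0 < C₁ := by simp [C₁, hDpos]
  have p2 : 0 < C₂ := by positivity
  have p3 : 0 < C₃ := by positivity
  refine ⟨C₁ + C₂ + C₃, by positivity, fun r₁ r₂ e h1 h2 he1 he => ?_⟩
  have he0 : 0 ≤ e := (abs_nonneg _).trans h1
  have hdd : |(α₁ - α₂) - (r₁ - r₂)| ≤ 2 * e := by
    calc _ = |(α₁ - r₁) - (α₂ - r₂)| := by ring_nf
      _ ≤ _ := abs_sub _ _
      _ ≤ _ := by linarith
  have b1 := abs_div_sub_div_le (x := 1) (x' := 1) (A := 0) hd (by simp) hdd he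
  have b2 := abs_div_sub_div_le (x := -(α₂ + α₁)) (x' := -(r₂ + r₁)) (A := 2) hd (by
    calc _ = |(α₁ - r₁) + (α₂ - r₂)| := by rw [← abs_neg]; ring_nf
      _ ≤ _ := abs_add_le _ _
      _ ≤ _ := by linarith) hdd he
  have b3 := abs_div_sub_div_le (x := α₁ * α₂) (x' := r₁ * r₂) (A := |α₁| + |α₂| + 1) hd (by
    calc |α₁ * α₂ - r₁ * r₂|
        = |α₁ * (α₂ - r₂) + (α₂ * (α₁ - r₁) - (α₁ - r₁) * (α₂ - r₂))| := by ring_nf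
      _ ≤ |α₁ * (α₂ - r₂)| + (|α₂ * (α₁ - r₁)| + |(α₁ - r₁) * (α₂ - r₂)|) :=
        (abs_add_le _ _).trans (by gcongr; exact abs_sub _ _)
      _ = |α₁| * |α₂ - r₂| + (|α₂| * |α₁ - r₁| + |α₁ - r₁| * |α₂ - r₂|) := by
        simp only [abs_mul]
      _ ≤ |α₁| * e + (|α₂| * e + 1 * e) := by
        gcongr
        exact h1.trans he1
      _ = _ := by ring) hdd he
  refine (min_le_left _ _).trans (max_le ?_ (max_le ?_ ?_))
  · simp only [mdCoeffs, mul_one, one_mul]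
    refine b1.trans (mul_le_mul_of_nonneg_right ?_ he0)
    change C₁ ≤ _
    linarith
  · simp only [mdCoeffs, mul_one, one_mul]
    refine b2.trans (mul_le_mul_of_nonneg_right ?_ he0)
    change C₂ ≤ _
    linarith
  · simp only [mdCoeffs, mul_one, one_mul]
    refine b3.trans (mul_le_mul_of_nonneg_right ?_ he0)
    change C₃ ≤ _
    linarith

/-- For badly approximable eigenlines the best approximation of size `N` has discrepancy
`O(1/N²)`. -/
theorem exists_rho_le {α₁ α₂ B : ℝ} (hne : α₁ ≠ α₂)
    (hbad : ∀ p q : ℤ, ¬(p = 0 ∧ q = 0) → 1 ≤ B * |(p - α₁ * q) * (p - α₂ * q)|) :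
    ∃ C : ℝ, ∃ N₀ : ℕ, 0 < C ∧ ∀ N : ℕ, N₀ ≤ N → 0 < N → ∃ v w : ℤ × ℤ,
      IsRationalOfSize N v w ∧ rho α₁ α₂ v w * (N : ℝ) ^ 2 ≤ C := by
  obtain ⟨K₁, M₁, hK₁, hA₁⟩ := exists_rat_approx hbad
  obtain ⟨K₂, M₂, hK₂, hA₂⟩ := exists_rat_approx (α := α₂) (β := α₁) (B := B) (fun p q h => by
    rw [mul_comm ((p : ℝ) - α₂ * q)]
    exact hbad p q h)
  obtain ⟨C, hC, hdisc⟩ := exists_discrepancy_le hne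
  have hdpos : 0 < |α₁ - α₂| := abs_pos.2 (sub_ne_zero.2 hne)
  set η := min 1 (|α₁ - α₂| / 4) with hη
  have hηpos : 0 < η := by positivity
  obtain ⟨M₃, hM₃⟩ := exists_nat_ge ((K₁ + K₂) / η)
  refine ⟨C * (K₁ + K₂), max M₁ (max M₂ M₃), by positivity, fun N hN hNpos => ?_⟩
  simp only [max_le_iff] at hN
  have hNr : (0 : ℝ) < N := by exact_mod_cast hNpos
  have hN1 : (1 : ℝ) ≤ N := by exact_mod_cast hNpos
  obtain ⟨r₁, hn₁, hd₁, ha₁⟩ := hA₁ N hN.1 hNpos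
  obtain ⟨r₂, hn₂, hd₂, ha₂⟩ := hA₂ N hN.2.1 hNpos
  set e := (K₁ + K₂) / (N : ℝ) ^ 2 with he
  have he₁ : |α₁ - r₁| ≤ e := ha₁.trans (by rw [he]; gcongr; linarith)
  have he₂ : |α₂ - r₂| ≤ e := ha₂.trans (by rw [he]; gcongr; linarith)
  have heη : e ≤ η := by
    have h3 : (M₃ : ℝ) ≤ N := by exact_mod_cast hN.2.2
    have h4 := (div_le_iff₀ hηpos).1 (hM₃.trans h3)
    rw [he, div_le_iff₀ (by positivity)]
    nlinarith [mul_nonneg hηpos.le (mul_nonneg hNr.le (sub_nonneg.2 hN1))]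
  have he1 : e ≤ 1 := heη.trans (min_le_left _ _)
  have he4 : e ≤ |α₁ - α₂| / 4 := heη.trans (min_le_right _ _)
  have hr : r₁ ≠ r₂ := by
    rintro rfl
    have := abs_sub_le α₁ r₁ α₂
    rw [abs_sub_comm (r₁ : ℝ)] at this
    linarith
  refine ⟨(r₁.num, r₁.den), (r₂.num, r₂.den), ⟨r₁.reduced, r₂.reduced, ?_, ?_⟩, ?_⟩
  · intro h
    apply hr
    rw [Rat.eq_iff_mul_eq_mul]
    linarith
  · simp [hn₁, hn₂, hd₁, hd₂]
  · have h := hdisc r₁ r₂ e he₁ he₂ he1 he4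
    rw [← mdCoeffs_num_den] at h
    calc _ ≤ C * e * (N : ℝ) ^ 2 := by
          gcongr
          simpa [rho] using h
      _ = C * (K₁ + K₂) := by
        rw [he]
        field_simp

/-- The Markoff-Davenport form is bounded on the vectors spanning best approximations. -/
theorem exists_mdForm_le {α₁ α₂ B : ℝ} (hne : α₁ ≠ α₂)
    (hbad : ∀ p q : ℤ, ¬(p = 0 ∧ q = 0) → 1 ≤ B * |(p - α₁ * q) * (p - α₂ * q)|) :
    ∃ C : ℝ, 0 < C ∧ ∀ N : ℕ, 0 < N → ∀ v w : ℤ × ℤ, IsRationalOfSize N v w →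
      (∀ v' w' : ℤ × ℤ, IsRationalOfSize N v' w' → rho α₁ α₂ v w ≤ rho α₁ α₂ v' w') →
      |mdForm α₁ α₂ v.1 v.2| ≤ C ∧ |mdForm α₁ α₂ w.1 w.2| ≤ C := by
  obtain ⟨C, N₀, hC, hrho⟩ := exists_rho_le hne hbad
  set c := mdCoeffs α₁ 1 α₂ 1 with hc
  set m := max |c.1| (max |c.2.1| |c.2.2|) with hm
  have hm0 : 0 ≤ m := (abs_nonneg _).trans (le_max_left _ _)
  refine ⟨3 * C + 3 * (m * (N₀ : ℝ) ^ 2), by positivity, fun N hN v w hvw hbest => ?_⟩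
  obtain ⟨⟨hv1, hv2⟩, hw1, hw2⟩ := hvw.abs_le
  rw [← quadForm_mdCoeffs_eq_mdForm, ← quadForm_mdCoeffs_eq_mdForm, ← hc]
  rcases le_total N₀ N with h | h
  · obtain ⟨v', w', hvw', hle⟩ := hrho N h hN
    have hle' : rho α₁ α₂ v w * (N : ℝ) ^ 2 ≤ C :=
      (mul_le_mul_of_nonneg_right (hbest v' w' hvw') (by positivity)).trans hle
    have hpos : 0 ≤ 3 * (m * (N₀ : ℝ) ^ 2) := by positivity
    unfold rho at hle'
    rw [← hc] at hle'
    constructor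
    · refine (abs_quadForm_le_discrepancy (c := c) (d := mdCoeffs v.1 v.2 w.1 w.2)
        ?_ hv1 hv2).trans (by linarith)
      rw [quadForm_mdCoeffs, mul_comm (v.2 : ℝ) v.1, sub_self, zero_mul, zero_div]
    · refine (abs_quadForm_le_discrepancy (c := c) (d := mdCoeffs v.1 v.2 w.1 w.2)
        ?_ hw1 hw2).trans (by linarith)
      rw [quadForm_mdCoeffs, mul_comm (w.2 : ℝ) w.1, sub_self, mul_zero, zero_div]
  · have h' : (N : ℝ) ≤ N₀ := by exact_mod_cast h
    constructor
    · have := abs_quadForm_le (c := c) hm.ge (hv1.trans h') (hv2.trans h')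
      linarith
    · have := abs_quadForm_le (c := c) hm.ge (hw1.trans h') (hw2.trans h')
      linarith

/-- Theorem (`sails`): for an algebraic hyperbolic MCRS-group `A` there is a
constant `C > 0` such that for every `N` the primitive vectors `v₁, v₂`
defining the best approximation of size at most `N` have bounded
Markoff-Davenport values `|Φ_A(vᵢ)| ≤ C`; consequently, whenever `vᵢ` lies on
the `kᵢ`-geometric continued fraction, `kᵢ < C/α` for the Markoff minimum `α`. -/
theorem best_approx_on_bounded_sails (α₁ α₂ : ℝ)
    (h₁ : IsQuadraticIrrational α₁) (h₂ : IsQuadraticIrrational α₂)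
    (hne : α₁ ≠ α₂) (halg : IsAlgebraicPair α₁ α₂)
    (a : ℝ) (hmin : IsLeast {t : ℝ | 0 < t ∧ ∃ p q : ℤ, t = |mdForm α₁ α₂ p q|} a) :
    ∃ C : ℝ, 0 < C ∧
      ∀ N : ℕ, 0 < N → ∀ v w : ℤ × ℤ, IsRationalOfSize N v w →
        (∀ v' w' : ℤ × ℤ, IsRationalOfSize N v' w' →
          rho α₁ α₂ v w ≤ rho α₁ α₂ v' w') →
        |mdForm α₁ α₂ v.1 v.2| ≤ C ∧ |mdForm α₁ α₂ w.1 w.2| ≤ C ∧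
        (∀ k : ℕ, (((v.1 : ℝ), (v.2 : ℝ)) ∈ geomCF α₁ α₂ k → (k : ℝ) < C / a) ∧
          (((w.1 : ℝ), (w.2 : ℝ)) ∈ geomCF α₁ α₂ k → (k : ℝ) < C / a)) := by
  obtain ⟨c, hc, hint⟩ := halg.exists_int
  have hc' : 0 < |(c : ℝ)| := abs_pos.2 (by exact_mod_cast hc)
  have hbad : ∀ p q : ℤ, ¬(p = 0 ∧ q = 0) →
      1 ≤ |(c : ℝ)| * |(p - α₁ * q) * (p - α₂ * q)| := by
    intro p q hpq
    obtain ⟨n, hn⟩ := hint p q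
    rw [← abs_mul]
    exact one_le_abs_of_eq_intCast hn (mul_ne_zero (by exact_mod_cast hc)
      (mul_ne_zero (h₁.1.sub_mul_ne_zero hpq) (h₂.1.sub_mul_ne_zero hpq)))
  obtain ⟨C, hC, hbound⟩ := exists_mdForm_le hne hbad
  have ha : 0 < a := hmin.1.1
  have hdpos : 0 < |α₁ - α₂| := abs_pos.2 (sub_ne_zero.2 hne)
  have hP : 0 < a * (|(c : ℝ)| * (C * |α₁ - α₂|)) := by positivity
  have hk : ∀ (u : ℤ × ℤ) (k : ℕ), |mdForm α₁ α₂ u.1 u.2| ≤ C →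
      ((u.1 : ℝ), (u.2 : ℝ)) ∈ geomCF α₁ α₂ k →
      (k : ℝ) < (C + a * (|(c : ℝ)| * (C * |α₁ - α₂|))) / a := by
    intro u k hu hmem
    have h := le_of_mem_geomCF h₁.1 h₂.1 hc hint hmem
    rw [mdForm, abs_div, div_le_iff₀ hdpos] at hu
    have h' := (div_le_iff₀ hc').1 (h.trans hu)
    rw [lt_div_iff₀ ha]
    nlinarith [mul_le_mul_of_nonneg_right h' ha.le]
  refine ⟨C + a * (|(c : ℝ)| * (C * |α₁ - α₂|)), by positivity, fun N hN v w hvw hbest => ?_⟩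
  obtain ⟨hv, hw⟩ := hbound N hN v w hvw hbest
  exact ⟨by linarith, by linarith, fun k => ⟨hk v k hv, hk w k hw⟩⟩
end
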